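/- arXiv:1703.05483 — 3 statements merged into one kernel-verified Lean document; each statement's English description precedes it below -/
import Mathlib

section
/- Under Assumptions 1 and 2, the switched system ẋ(t) = f_{σ(t)}(x(t)) is globally asymptotically stable under every switching signal σ that satisfies limsup_{t→+∞} ( ν(t) · Σ_{(k,ℓ)∈E(P)} (ln μ_{kℓ}) ρ_{kℓ}(t) − Σ_{j∈P_S} |λ_j| η_j(t) + Σ_{k∈P_U} |λ_k| η_k(t) ) < 0, where λ_i and μ_{kℓ} are the constants from Assumptions 1 and 2. -/
open Filter MeasureTheory Set

noncomputable section

/-- A switching signal: strictly increasing switching instants `tau 0 = 0 < tau 1 < ...`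
tending to `+∞`, together with the signal `sig` itself, constant on `[tau i, tau (i+1))`
and actually switching at each `tau (i+1)`. -/
structure SwitchSig (P : Type*) where
  tau : ℕ → ℝ
  sig : ℝ → P
  tau0 : tau 0 = 0
  mono : StrictMono tau
  tends : Filter.Tendsto tau Filter.atTop Filter.atTop
  const : ∀ i : ℕ, ∀ t : ℝ, tau i ≤ t → t < tau (i + 1) → sig t = sig (tau i)
  switch : ∀ i : ℕ, sig (tau i) ≠ sig (tau (i + 1))

namespace SwitchSig

variable {P : Type*} (S : SwitchSig P)

/-- `N s t` : the number of switching instants in `(s, t]`. -/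
def N (s t : ℝ) : ℕ := Set.ncard {i : ℕ | s < S.tau i ∧ S.tau i ≤ t}

/-- `Ntrans k l t` : the number of transitions from `k` to `l` occurring up to time `t`. -/
def Ntrans (k l : P) (t : ℝ) : ℕ :=
  Set.ncard {i : ℕ | S.tau (i + 1) ≤ t ∧ S.sig (S.tau i) = k ∧ S.sig (S.tau (i + 1)) = l}

/-- `Nmode j s t` : the number of switching instants in `(s, t]` at which subsystem `j`
is activated. -/
def Nmode (j : P) (s t : ℝ) : ℕ :=
  Set.ncard {i : ℕ | s < S.tau i ∧ S.tau i ≤ t ∧ S.sig (S.tau i) = j}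

/-- `T j s t` : the total duration of activation of subsystem `j` on `(s, t]`
(Lebesgue measure). -/
def T (j : P) (s t : ℝ) : ℝ :=
  (MeasureTheory.volume {r : ℝ | s < r ∧ r ≤ t ∧ S.sig r = j}).toReal

/-- switching frequency `ν(t) = N(0,t)/t`. -/
def nu (t : ℝ) : ℝ := (S.N 0 t : ℝ) / t

/-- transition frequency `ρ_{kl}(t) = N_{kl}(0,t)/N(0,t)`. -/
def rho (k l : P) (t : ℝ) : ℝ := (S.Ntrans k l t : ℝ) / (S.N 0 t : ℝ)

/-- fraction of activation `η_j(t) = T_j(0,t)/t`. -/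
def eta (j : P) (t : ℝ) : ℝ := S.T j 0 t / t

end SwitchSig

/-- A (Carathéodory-type) solution of the switched system `ẋ = f_{σ(t)}(x)`:
continuous on `[0, ∞)` and differentiable, with the prescribed derivative, in the
interior of every inter-switch interval. -/
def IsSolution {P : Type*} {E : Type*} [NormedAddCommGroup E] [NormedSpace ℝ E]
    (S : SwitchSig P) (f : P → E → E) (x : ℝ → E) : Prop :=
  ContinuousOn x (Set.Ici (0 : ℝ)) ∧
  ∀ i : ℕ, ∀ t : ℝ, S.tau i < t → t < S.tau (i + 1) →
    HasDerivAt x (f (S.sig t) (x t)) t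

/-- Class `K∞` functions. -/
def ClassKInf (g : ℝ → ℝ) : Prop :=
  ContinuousOn g (Set.Ici (0 : ℝ)) ∧ StrictMonoOn g (Set.Ici (0 : ℝ)) ∧ g 0 = 0 ∧
  Filter.Tendsto g Filter.atTop Filter.atTop

/-- Assumption 1: Lyapunov-like functions `V i`, sandwiched between class-`K∞`
functions of the norm, decaying at rate `lam i` (positive on `PS`, negative on `PU`)
along solutions of each subsystem. -/
def Assumption1 {P : Type*} {E : Type*} [NormedAddCommGroup E] [NormedSpace ℝ E]
    (f : P → E → E) (V : P → E → ℝ) (lam : P → ℝ) (PS PU : Finset P)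
    (lo hi : ℝ → ℝ) : Prop :=
  ClassKInf lo ∧ ClassKInf hi ∧
  (∀ i : P, ContDiff ℝ 1 (V i)) ∧
  (∀ i : P, ∀ ξ : E, 0 ≤ V i ξ) ∧
  (∀ j ∈ PS, 0 < lam j) ∧ (∀ k ∈ PU, lam k < 0) ∧
  (∀ i : P, ∀ ξ : E, lo ‖ξ‖ ≤ V i ξ ∧ V i ξ ≤ hi ‖ξ‖) ∧
  (∀ i : P, ∀ γ : ℝ → E, ContinuousOn γ (Set.Ici (0 : ℝ)) →
    (∀ t : ℝ, 0 < t → HasDerivAt γ (f i (γ t)) t) →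
    ∀ t : ℝ, 0 ≤ t → V i (γ t) ≤ V i (γ 0) * Real.exp (-(lam i) * t))

/-- Assumption 2: for every admissible transition `(i, j)` there is `μ_{ij} ≥ 1`
with `V j ≤ μ_{ij} • V i` pointwise. -/
def Assumption2 {P : Type*} {E : Type*}
    (V : P → E → ℝ) (mu : P → P → ℝ) (Eadm : Finset (P × P)) : Prop :=
  ∀ p ∈ Eadm, 1 ≤ mu p.1 p.2 ∧ ∀ ξ : E, V p.2 ξ ≤ mu p.1 p.2 * V p.1 ξ

/-- Global asymptotic stability of the switched system under the switching signal `S`: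
Lyapunov stability together with global asymptotic convergence of every solution. -/
def IsGAS {P : Type*} {E : Type*} [NormedAddCommGroup E] [NormedSpace ℝ E]
    (S : SwitchSig P) (f : P → E → E) : Prop :=
  (∀ ε : ℝ, 0 < ε → ∃ δ : ℝ, 0 < δ ∧ ∀ x : ℝ → E, IsSolution S f x → ‖x 0‖ < δ →
      ∀ t : ℝ, 0 ≤ t → ‖x t‖ < ε) ∧
  ∀ x : ℝ → E, IsSolution S f x → Filter.Tendsto x Filter.atTop (nhds (0 : E))

section GlobalFlow

variable {E : Type*} [NormedAddCommGroup E] [NormedSpace ℝ E]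

/-- A Lipschitz vector field has integral curves on a time interval whose length does not depend
on the initial point. -/
theorem LipschitzWith.exists_uniform_time_hasDerivWithinAt [CompleteSpace E] {f : E → E}
    {K : NNReal} (hf : LipschitzWith K f) :
    ∃ h : ℝ, 0 < h ∧ ∀ x : E, ∃ α : ℝ → E, α 0 = x ∧
      ∀ t ∈ Icc 0 h, HasDerivWithinAt α (f (α t)) (Icc 0 h) t := by
  have hK : (0 : ℝ) < K + 1 := by positivity
  have hh : (0 : ℝ) < 1 / (K + 1) := by positivity
  refine ⟨1 / (K + 1), hh, fun x ↦ ?_⟩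
  let a : NNReal := ‖f x‖₊ + 1
  have hpl : IsPicardLindelof (fun _ ↦ f) (⟨0, le_rfl, hh.le⟩ : Icc (0 : ℝ) (1 / (K + 1)))
      x a 0 (‖f x‖₊ + K * a) K := by
    refine IsPicardLindelof.of_time_independent (fun y hy ↦ ?_) hf.lipschitzOnWith ?_
    · have hxy := hf.norm_sub_le y x
      have hya : ‖y - x‖ ≤ a := by simpa [dist_eq_norm] using hy
      calc ‖f y‖ ≤ ‖f x‖ + ‖f y - f x‖ := by
            simpa using norm_add_le (f x) (f y - f x)
        _ ≤ ‖f x‖ + K * a := by gcongr; exact hxy.trans (by gcongr)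
        _ = _ := by simp
    · simp only [sub_zero, sub_self, max_eq_left hh.le, NNReal.coe_zero]
      rw [mul_one_div, div_le_iff₀ hK]
      simp only [a, NNReal.coe_add, NNReal.coe_mul, coe_nnnorm, NNReal.coe_one]
      linarith [norm_nonneg (f x)]
  exact hpl.exists_eq_forall_mem_Icc_hasDerivWithinAt₀

/-- Forward global existence for Lipschitz vector fields. -/
theorem LipschitzWith.exists_forward_solution [CompleteSpace E] {f : E → E}
    {K : NNReal} (hf : LipschitzWith K f) (x : E) :
    ∃ y : ℝ → E, y 0 = x ∧ (∀ t, 0 ≤ t → HasDerivWithinAt y (f (y t)) (Ici t) t) ∧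
      ∀ t, 0 < t → HasDerivAt y (f (y t)) t := by
  obtain ⟨h, hh, H⟩ := hf.exists_uniform_time_hasDerivWithinAt
  choose φ hφ0 hφ using H
  let X : ℕ → E := fun n ↦ (fun z ↦ φ z h)^[n] x
  have hX : ∀ n, X (n + 1) = φ (X n) h := fun n ↦ Function.iterate_succ_apply' _ _ _
  let y : ℝ → E := fun t ↦ φ (X ⌊t / h⌋₊) (t - ⌊t / h⌋₊ * h)
  have hy : ∀ (n : ℕ), ∀ t ∈ Icc (n * h) ((n + 1) * h), y t = φ (X n) (t - n * h) := by
    intro n t ht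
    rcases ht.2.lt_or_eq with hlt | rfl
    · have : ⌊t / h⌋₊ = n := by
        have hn : (0 : ℝ) ≤ n * h := by positivity
        rw [Nat.floor_eq_iff (div_nonneg (hn.trans ht.1) hh.le)]
        exact ⟨(le_div_iff₀ hh).2 ht.1, (div_lt_iff₀ hh).2 hlt⟩
      simp only [y, this]
    · have : ⌊((n : ℝ) + 1) * h / h⌋₊ = n + 1 := by
        rw [mul_div_cancel_right₀ _ hh.ne']
        exact_mod_cast Nat.floor_natCast (R := ℝ) (n + 1)
      simp only [y, this]
      push_cast
      rw [sub_self, hφ0, hX]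
      ring_nf
  have hd : ∀ (n : ℕ), ∀ t ∈ Icc (n * h) ((n + 1) * h),
      HasDerivWithinAt y (f (y t)) (Icc (n * h) ((n + 1) * h)) t := by
    intro n t ht
    have h1 := hφ (X n) (t - n * h) ⟨by linarith [ht.1], by linarith [ht.2]⟩
    have h2 : HasDerivWithinAt (fun s ↦ φ (X n) (s - n * h)) (f (φ (X n) (t - n * h)))
        (Icc (n * h) ((n + 1) * h)) t := by
      have h3 := h1.scomp t ((hasDerivWithinAt_id t (Icc (n * h) ((n + 1) * h))).sub_const (n * h))
        (fun s hs ↦ by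
          simp only [id, mem_Icc] at hs ⊢
          constructor <;> linarith [hs.1, hs.2])
      simpa [Function.comp_def] using h3
    rw [hy n t ht]
    exact h2.congr_of_mem (hy n) ht
  have hright : ∀ t, 0 ≤ t → HasDerivWithinAt y (f (y t)) (Ici t) t := by
    intro t ht
    have ha : ⌊t / h⌋₊ * h ≤ t := (le_div_iff₀ hh).1 (Nat.floor_le (div_nonneg ht hh.le))
    have hb : t < (⌊t / h⌋₊ + 1) * h := (div_lt_iff₀ hh).1 (Nat.lt_floor_add_one _)
    exact (hd _ t ⟨ha, hb.le⟩).mono_of_mem_nhdsWithin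
      (mem_of_superset (Icc_mem_nhdsGE hb) (Icc_subset_Icc_left ha))
  refine ⟨y, ?_, hright, fun t ht ↦ ?_⟩
  · simp [y, X, hφ0]
  obtain ⟨m, hm⟩ : ∃ m : ℕ, ⌈t / h⌉₊ = m + 1 :=
    Nat.exists_eq_succ_of_ne_zero (Nat.ceil_pos.2 (div_pos ht hh)).ne'
  obtain ⟨hm1, hm2⟩ := (Nat.ceil_eq_iff (Nat.succ_ne_zero m)).1 hm
  have ha : m * h < t := (lt_div_iff₀ hh).1 (by simpa using hm1)
  have hb : t ≤ (m + 1) * h := (div_le_iff₀ hh).1 (by simpa using hm2)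
  have hleft : HasDerivWithinAt y (f (y t)) (Iic t) t :=
    (hd m t ⟨ha.le, hb⟩).mono_of_mem_nhdsWithin
      (mem_of_superset (Icc_mem_nhdsLE ha) (Icc_subset_Icc_right hb))
  have hu := hleft.union (hright t ht.le)
  rwa [Iic_union_Ici, hasDerivWithinAt_univ] at hu

/-- A curve that is continuous on `[a, b]` and solves an autonomous ODE with continuous right-hand
side on `(a, b)` also solves it from the right at `a`. -/
theorem hasDerivWithinAt_Ici_of_hasDerivAt_Ioo {f : E → E} (hf : Continuous f) {x : ℝ → E}
    {a b : ℝ} (hab : a < b) (hx : ContinuousOn x (Icc a b))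
    (hd : ∀ t ∈ Ioo a b, HasDerivAt x (f (x t)) t) :
    HasDerivWithinAt x (f (x a)) (Ici a) a := by
  have hIoo : Ioo a b ∈ nhdsWithin a (Ioi a) := Ioo_mem_nhdsGT hab
  have hc : ContinuousWithinAt x (Ioo a b) a :=
    (hx a (left_mem_Icc.2 hab.le)).mono Ioo_subset_Icc_self
  refine hasDerivWithinAt_Ici_of_tendsto_deriv
    (fun t ht ↦ (hd t ht).differentiableAt.differentiableWithinAt) hc hIoo ?_
  have hc' : Tendsto x (nhdsWithin a (Ioi a)) (nhds (x a)) :=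
    hc.mono_left (nhdsWithin_le_of_mem hIoo)
  refine ((hf.tendsto (x a)).comp hc').congr' ?_
  filter_upwards [hIoo] with t ht
  exact (hd t ht).deriv.symm

/-- An exponential bound along all forward solutions of a Lipschitz ODE also holds along solutions
that are only defined on a compact interval. -/
theorem le_mul_exp_of_solution_Icc [CompleteSpace E] {f : E → E} {K : NNReal}
    (hf : LipschitzWith K f) {V : E → ℝ} {c : ℝ}
    (hV : ∀ γ : ℝ → E, ContinuousOn γ (Ici 0) → (∀ t, 0 < t → HasDerivAt γ (f (γ t)) t) →
      ∀ t, 0 ≤ t → V (γ t) ≤ V (γ 0) * Real.exp (-c * t))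
    {x : ℝ → E} {a b : ℝ} (hab : a < b) (hx : ContinuousOn x (Icc a b))
    (hd : ∀ t ∈ Ioo a b, HasDerivAt x (f (x t)) t) {t : ℝ} (ht : t ∈ Icc a b) :
    V (x t) ≤ V (x a) * Real.exp (-c * (t - a)) := by
  obtain ⟨y, hy0, hyr, hyd⟩ := hf.exists_forward_solution (x a)
  have hyc : ContinuousOn y (Ici 0) := by
    intro s hs
    rcases (mem_Ici.1 hs).eq_or_lt with rfl | hlt
    · exact (hyr 0 le_rfl).continuousWithinAt
    · exact (hyd s hlt).continuousAt.continuousWithinAt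
  have hshift : MapsTo (fun s ↦ s - a) (Icc a b) (Ici 0) := fun s hs ↦ sub_nonneg.2 hs.1
  have heq : EqOn x (fun s ↦ y (s - a)) (Icc a b) := by
    refine ODE_solution_unique_of_mem_Icc_right (v := fun _ ↦ f) (s := fun _ ↦ univ)
      (fun _ _ ↦ hf.lipschitzOnWith) hx (fun s hs ↦ ?_) (fun _ _ ↦ mem_univ _)
      (hyc.comp (by fun_prop) hshift) (fun s hs ↦ ?_) (fun _ _ ↦ mem_univ _) (by simp [hy0])
    · rcases hs.1.eq_or_lt with rfl | hlt
      · exact hasDerivWithinAt_Ici_of_hasDerivAt_Ioo hf.continuous hab hx hd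
      · exact (hd s ⟨hlt, hs.2⟩).hasDerivWithinAt
    · have h3 := (hyr (s - a) (sub_nonneg.2 hs.1)).scomp s
        ((hasDerivWithinAt_id s (Ici s)).sub_const a) (fun r hr ↦ by simpa using hr)
      simpa [Function.comp_def] using h3
  have hxt : x t = y (t - a) := heq ht
  rw [hxt, ← hy0]
  exact hV y hyc hyd (t - a) (sub_nonneg.2 ht.1)

end GlobalFlow

namespace SwitchSig

variable {P : Type*} (S : SwitchSig P)

theorem tau_nonneg (n : ℕ) : 0 ≤ S.tau n := S.tau0 ▸ S.mono.monotone (Nat.zero_le n)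

theorem exists_tau_le_lt {t : ℝ} (ht : 0 ≤ t) : ∃ n, S.tau n ≤ t ∧ t < S.tau (n + 1) := by
  classical
  have hex : ∃ m, t < S.tau m := (S.tends.eventually_gt_atTop t).exists
  obtain ⟨n, hn⟩ : ∃ n, Nat.find hex = n + 1 := by
    refine Nat.exists_eq_succ_of_ne_zero fun h0 ↦ ?_
    have := Nat.find_spec hex
    rw [h0, S.tau0] at this
    exact this.not_ge ht
  exact ⟨n, not_lt.1 (Nat.find_min hex (hn ▸ Nat.lt_succ_self n)), hn ▸ Nat.find_spec hex⟩

theorem finite_tau_succ_le (t : ℝ) : {i : ℕ | S.tau (i + 1) ≤ t}.Finite := by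
  obtain ⟨m, hm⟩ := (S.tends.eventually_gt_atTop t).exists
  refine (finite_lt_nat m).subset fun i hi ↦ ?_
  exact (Nat.lt_succ_self i).trans (S.mono.lt_iff_lt.1 ((mem_ofPred.1 hi).trans_lt hm))

theorem Ntrans_mono (k l : P) : Monotone (S.Ntrans k l) := fun _ t hst ↦
  ncard_le_ncard (fun _ hi ↦ ⟨hi.1.trans hst, hi.2⟩)
    ((S.finite_tau_succ_le t).subset fun _ hi ↦ hi.1)

theorem Ntrans_eq_zero_of_N_eq_zero {t : ℝ} (h : S.N 0 t = 0) (k l : P) : S.Ntrans k l t = 0 := by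
  have hfin : {i : ℕ | 0 < S.tau i ∧ S.tau i ≤ t}.Finite := by
    refine ((S.finite_tau_succ_le t).image Nat.succ).subset fun i hi ↦ ?_
    obtain ⟨m, rfl⟩ : ∃ m, i = m + 1 := Nat.exists_eq_succ_of_ne_zero (by
      rintro rfl
      exact hi.1.ne' S.tau0)
    exact ⟨m, hi.2, rfl⟩
  have hempty := (ncard_eq_zero hfin).1 h
  have : {i : ℕ | S.tau (i + 1) ≤ t ∧ S.sig (S.tau i) = k ∧ S.sig (S.tau (i + 1)) = l} = ∅ := by
    refine eq_empty_of_forall_notMem fun i hi ↦ ?_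
    have : i + 1 ∈ {i : ℕ | 0 < S.tau i ∧ S.tau i ≤ t} :=
      ⟨(S.tau_nonneg i).trans_lt (S.mono (Nat.lt_succ_self i)), hi.1⟩
    simp [hempty] at this
  rw [Ntrans, this, ncard_empty]

theorem nu_mul_rho (k l : P) (t : ℝ) : S.nu t * S.rho k l t = S.Ntrans k l t / t := by
  rcases eq_or_ne (S.N 0 t) 0 with h | h
  · simp [nu, h, S.Ntrans_eq_zero_of_N_eq_zero h]
  · have : (S.N 0 t : ℝ) ≠ 0 := Nat.cast_ne_zero.2 h
    rw [nu, rho, mul_comm, div_mul_div_comm, mul_comm (S.N 0 t : ℝ) t,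
      mul_div_mul_right _ _ this]

theorem Ntrans_zero (k l : P) : S.Ntrans k l 0 = 0 := by
  have : {i : ℕ | S.tau (i + 1) ≤ 0 ∧ S.sig (S.tau i) = k ∧ S.sig (S.tau (i + 1)) = l} = ∅ :=
    eq_empty_of_forall_notMem fun i hi ↦
      hi.1.not_gt ((S.tau_nonneg i).trans_lt (S.mono (Nat.lt_succ_self i)))
  rw [Ntrans, this, ncard_empty]

theorem Ntrans_of_tau_le_lt (k l : P) {n : ℕ} {t : ℝ} (h1 : S.tau n ≤ t) (h2 : t < S.tau (n + 1)) :
    S.Ntrans k l t = S.Ntrans k l (S.tau n) := by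
  unfold Ntrans
  congr 1
  ext i
  refine and_congr_left fun _ ↦ ⟨fun hi ↦ S.mono.monotone ?_, fun hi ↦ hi.trans h1⟩
  exact Nat.lt_succ_iff.1 (S.mono.lt_iff_lt.1 (hi.trans_lt h2))

open Classical in
theorem Ntrans_tau_succ (k l : P) (n : ℕ) :
    S.Ntrans k l (S.tau (n + 1)) = S.Ntrans k l (S.tau n) +
      if (S.sig (S.tau n), S.sig (S.tau (n + 1))) = (k, l) then 1 else 0 := by
  unfold Ntrans
  simp only [S.mono.le_iff_le, Nat.succ_le_iff, Prod.mk.injEq]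
  split_ifs with h
  · rw [← ncard_insert_of_notMem (a := n) (by simp)
      ((finite_lt_nat n).subset fun i hi ↦ hi.1)]
    congr 1
    ext i
    simp only [mem_ofPred_eq, mem_insert_iff]
    constructor
    · rintro ⟨hi, h'⟩
      exact (Nat.lt_succ_iff_lt_or_eq.1 hi).symm.imp id fun hi ↦ ⟨hi, h'⟩
    · rintro (rfl | ⟨hi, h'⟩)
      · exact ⟨Nat.lt_succ_self _, h⟩
      · exact ⟨hi.trans (Nat.lt_succ_self n), h'⟩
  · rw [add_zero]
    congr 1
    ext i
    simp only [mem_ofPred_eq]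
    refine and_congr_left fun h' ↦ ⟨fun hi ↦ ?_, fun hi ↦ hi.trans (Nat.lt_succ_self n)⟩
    refine (Nat.lt_succ_iff.1 hi).lt_of_ne ?_
    rintro rfl
    exact h h'

theorem T_nonneg (j : P) (s t : ℝ) : 0 ≤ S.T j s t := ENNReal.toReal_nonneg

theorem T_le (j : P) {t : ℝ} (ht : 0 ≤ t) : S.T j 0 t ≤ t := by
  have hsub : {r : ℝ | 0 < r ∧ r ≤ t ∧ S.sig r = j} ⊆ Ioc 0 t := fun r hr ↦ ⟨hr.1, hr.2.1⟩
  refine (measureReal_mono (μ := volume) hsub measure_Ioc_lt_top.ne).trans_eq ?_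
  simp [ht]

theorem T_zero (j : P) : S.T j 0 0 = 0 :=
  le_antisymm (S.T_le j le_rfl) (S.T_nonneg j 0 0)

open Classical in
theorem T_of_tau_le_le (j : P) {n : ℕ} {t : ℝ} (h1 : S.tau n ≤ t) (h2 : t ≤ S.tau (n + 1)) :
    S.T j 0 t = S.T j 0 (S.tau n) + if S.sig (S.tau n) = j then t - S.tau n else 0 := by
  let B : Set ℝ := if S.sig (S.tau n) = j then Ioc (S.tau n) t else ∅
  have hB : B ⊆ Ioc (S.tau n) t := by
    simp only [B]
    split_ifs
    · rfl
    · exact empty_subset _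
  have hBm : MeasurableSet B := by
    simp only [B]
    split_ifs
    · exact measurableSet_Ioc
    · exact .empty
  have hae : {r : ℝ | 0 < r ∧ r ≤ t ∧ S.sig r = j} =ᵐ[volume]
      ({r : ℝ | 0 < r ∧ r ≤ S.tau n ∧ S.sig r = j} ∪ B : Set ℝ) := by
    have hne : ∀ᵐ r : ℝ ∂volume, r ≠ t := by
      simp [ae_iff]
    filter_upwards [hne] with r hr
    refine propext (Iff.trans (b := r ∈ {r : ℝ | 0 < r ∧ r ≤ t ∧ S.sig r = j}) Iff.rfl ?_)
    change _ ↔ r ∈ ({r : ℝ | 0 < r ∧ r ≤ S.tau n ∧ S.sig r = j} ∪ B : Set ℝ)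
    simp only [mem_ofPred_eq, mem_union]
    rcases le_or_gt r (S.tau n) with hrn | hrn
    · have : r ∉ B := fun h ↦ (hB h).1.not_ge hrn
      simp [this, hrn, hrn.trans h1]
    · have h0 : 0 < r := (S.tau_nonneg n).trans_lt hrn
      simp only [B, h0, hrn.not_ge, true_and, false_and, false_or]
      rcases lt_or_ge t r with htr | htr
      · split_ifs <;> simp [htr.not_ge]
      · have hs := S.const n r hrn.le ((htr.lt_of_ne hr).trans_le h2)
        split_ifs with h <;> simp [hs, h, htr, hrn]
  have hdisj : Disjoint {r : ℝ | 0 < r ∧ r ≤ S.tau n ∧ S.sig r = j} B :=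
    disjoint_left.2 fun r hr hr' ↦ (hB hr').1.not_ge hr.2.1
  have hsub : {r : ℝ | 0 < r ∧ r ≤ S.tau n ∧ S.sig r = j} ⊆ Ioc 0 (S.tau n) :=
    fun r hr ↦ ⟨hr.1, hr.2.1⟩
  have hfin : volume {r : ℝ | 0 < r ∧ r ≤ S.tau n ∧ S.sig r = j} ≠ ⊤ :=
    measure_ne_top_of_subset hsub measure_Ioc_lt_top.ne
  have hBfin : volume B ≠ ⊤ := measure_ne_top_of_subset hB measure_Ioc_lt_top.ne
  unfold T
  rw [measure_congr hae, measure_union hdisj hBm, ENNReal.toReal_add hfin hBfin]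
  congr 1
  simp only [B]
  split_ifs
  · simp [h1]
  · simp

/-- The cumulative exponent `∑ ln μ_{kl} N_{kl}(0,t) - ∑ λ_j T_j(0,t)` bounding the logarithmic
growth of a multiple Lyapunov function over `(0, t]`. -/
def exponent (lam : P → ℝ) (mu : P → P → ℝ) (Q : Finset P) (A : Finset (P × P)) (t : ℝ) : ℝ :=
  ∑ p ∈ A, Real.log (mu p.1 p.2) * S.Ntrans p.1 p.2 t - ∑ j ∈ Q, lam j * S.T j 0 t

variable (lam : P → ℝ) (mu : P → P → ℝ) {Q : Finset P} {A : Finset (P × P)}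

theorem exponent_zero : S.exponent lam mu Q A 0 = 0 := by
  simp [exponent, Ntrans_zero, T_zero]

theorem sum_mul_T_of_tau_le_le (hQ : ∀ i, i ∈ Q) {n : ℕ} {t : ℝ} (h1 : S.tau n ≤ t)
    (h2 : t ≤ S.tau (n + 1)) :
    ∑ j ∈ Q, lam j * S.T j 0 t =
      ∑ j ∈ Q, lam j * S.T j 0 (S.tau n) + lam (S.sig (S.tau n)) * (t - S.tau n) := by
  classical
  simp [S.T_of_tau_le_le _ h1 h2, mul_add, Finset.sum_add_distrib, hQ]

theorem exponent_of_tau_le_lt (hQ : ∀ i, i ∈ Q) {n : ℕ} {t : ℝ} (h1 : S.tau n ≤ t)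
    (h2 : t < S.tau (n + 1)) :
    S.exponent lam mu Q A t =
      S.exponent lam mu Q A (S.tau n) - lam (S.sig (S.tau n)) * (t - S.tau n) := by
  simp only [exponent, S.Ntrans_of_tau_le_lt _ _ h1 h2, S.sum_mul_T_of_tau_le_le lam hQ h1 h2.le]
  ring

theorem exponent_tau_succ (hQ : ∀ i, i ∈ Q) {n : ℕ}
    (hA : (S.sig (S.tau n), S.sig (S.tau (n + 1))) ∈ A) :
    S.exponent lam mu Q A (S.tau (n + 1)) = S.exponent lam mu Q A (S.tau n)
      + Real.log (mu (S.sig (S.tau n)) (S.sig (S.tau (n + 1))))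
      - lam (S.sig (S.tau n)) * (S.tau (n + 1) - S.tau n) := by
  classical
  simp only [exponent, S.sum_mul_T_of_tau_le_le lam hQ (S.mono.monotone (Nat.le_succ n)) le_rfl,
    S.Ntrans_tau_succ, Nat.cast_add, mul_add, Finset.sum_add_distrib, Prod.mk.eta]
  simp [hA]
  ring

theorem exponent_le_of_le (hmu : ∀ p ∈ A, 1 ≤ mu p.1 p.2) {t t₀ : ℝ} (ht : 0 ≤ t)
    (htt : t ≤ t₀) :
    S.exponent lam mu Q A t ≤
      ∑ p ∈ A, Real.log (mu p.1 p.2) * S.Ntrans p.1 p.2 t₀ + ∑ j ∈ Q, |lam j| * t₀ := by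
  have hN : ∑ p ∈ A, Real.log (mu p.1 p.2) * S.Ntrans p.1 p.2 t ≤
      ∑ p ∈ A, Real.log (mu p.1 p.2) * S.Ntrans p.1 p.2 t₀ :=
    Finset.sum_le_sum fun p hp ↦ mul_le_mul_of_nonneg_left
      (Nat.cast_le.2 (S.Ntrans_mono _ _ htt)) (Real.log_nonneg (hmu p hp))
  have hT : ∑ j ∈ Q, -(lam j * S.T j 0 t) ≤ ∑ j ∈ Q, |lam j| * t₀ := by
    refine Finset.sum_le_sum fun j _ ↦ ?_
    calc -(lam j * S.T j 0 t) = -lam j * S.T j 0 t := (neg_mul _ _).symm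
      _ ≤ |lam j| * t₀ := mul_le_mul (neg_le_abs _) ((S.T_le j ht).trans htt)
          (S.T_nonneg j 0 t) (abs_nonneg _)
  rw [Finset.sum_neg_distrib] at hT
  unfold exponent
  linarith

end SwitchSig

section Lyapunov

variable {P : Type*} {E : Type*} [NormedAddCommGroup E] [NormedSpace ℝ E]

theorem IsSolution.lyapunov_le [CompleteSpace E] {S : SwitchSig P} {f : P → E → E}
    {V : P → E → ℝ} {lam : P → ℝ} {mu : P → P → ℝ} {Q : Finset P} {A : Finset (P × P)}
    (hQ : ∀ i, i ∈ Q) (hLip : ∀ i, ∃ K : NNReal, LipschitzWith K (f i))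
    (hadm : ∀ i : ℕ, (S.sig (S.tau i), S.sig (S.tau (i + 1))) ∈ A)
    (hV : ∀ i, ∀ γ : ℝ → E, ContinuousOn γ (Ici 0) →
      (∀ t, 0 < t → HasDerivAt γ (f i (γ t)) t) →
      ∀ t, 0 ≤ t → V i (γ t) ≤ V i (γ 0) * Real.exp (-(lam i) * t))
    (h2 : Assumption2 V mu A) {x : ℝ → E} (hx : IsSolution S f x) {t : ℝ} (ht : 0 ≤ t) :
    V (S.sig t) (x t) ≤ V (S.sig 0) (x 0) * Real.exp (S.exponent lam mu Q A t) := by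
  have hpiece : ∀ n, ∀ s ∈ Icc (S.tau n) (S.tau (n + 1)), V (S.sig (S.tau n)) (x s) ≤
      V (S.sig (S.tau n)) (x (S.tau n)) *
        Real.exp (-lam (S.sig (S.tau n)) * (s - S.tau n)) := by
    intro n s hs
    obtain ⟨K, hK⟩ := hLip (S.sig (S.tau n))
    refine le_mul_exp_of_solution_Icc hK (hV _) (S.mono (Nat.lt_succ_self n))
      (hx.1.mono fun r hr ↦ (S.tau_nonneg n).trans hr.1) (fun r hr ↦ ?_) hs
    have := hx.2 n r hr.1 hr.2
    rwa [S.const n r hr.1.le hr.2] at this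
  have hinst : ∀ n, V (S.sig (S.tau n)) (x (S.tau n)) ≤
      V (S.sig 0) (x 0) * Real.exp (S.exponent lam mu Q A (S.tau n)) := by
    intro n
    induction n with
    | zero => simp [S.tau0, S.exponent_zero]
    | succ n ih =>
      obtain ⟨hmu, hjump⟩ := h2 _ (hadm n)
      have hmu0 : 0 < mu (S.sig (S.tau n)) (S.sig (S.tau (n + 1))) := one_pos.trans_le hmu
      calc V (S.sig (S.tau (n + 1))) (x (S.tau (n + 1)))
          ≤ mu (S.sig (S.tau n)) (S.sig (S.tau (n + 1))) *
              V (S.sig (S.tau n)) (x (S.tau (n + 1))) := hjump _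
        _ ≤ mu (S.sig (S.tau n)) (S.sig (S.tau (n + 1))) *
              (V (S.sig 0) (x 0) * Real.exp (S.exponent lam mu Q A (S.tau n)) *
                Real.exp (-lam (S.sig (S.tau n)) * (S.tau (n + 1) - S.tau n))) := by
            gcongr
            refine (hpiece n _ ⟨S.mono.monotone (Nat.le_succ n), le_rfl⟩).trans ?_
            gcongr
        _ = V (S.sig 0) (x 0) * Real.exp (S.exponent lam mu Q A (S.tau (n + 1))) := by
            rw [S.exponent_tau_succ lam mu hQ (hadm n), neg_mul, Real.exp_neg,
              Real.exp_sub, Real.exp_add, Real.exp_log hmu0]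
            ring
  obtain ⟨n, hn1, hn2⟩ := S.exists_tau_le_lt ht
  rw [S.const n t hn1 hn2, S.exponent_of_tau_le_lt lam mu hQ hn1 hn2, sub_eq_add_neg, ← neg_mul,
    Real.exp_add, ← mul_assoc]
  refine (hpiece n t ⟨hn1, hn2.le⟩).trans ?_
  gcongr
  exact hinst n

/-- A switched system is GAS as soon as its Lyapunov functions grow at most by an exponential
factor whose exponent is bounded above and tends to `-∞`. -/
theorem isGAS_of_lyapunov_le {S : SwitchSig P} {f : P → E → E} {V : P → E → ℝ} {lo hi ψ : ℝ → ℝ}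
    (hlo : ClassKInf lo) (hhi : ClassKInf hi)
    (hV : ∀ i ξ, lo ‖ξ‖ ≤ V i ξ ∧ V i ξ ≤ hi ‖ξ‖)
    {M : ℝ} (hM : ∀ t, 0 ≤ t → ψ t ≤ M) (hψ : Tendsto ψ atTop atBot)
    (h : ∀ x, IsSolution S f x → ∀ t, 0 ≤ t →
      V (S.sig t) (x t) ≤ V (S.sig 0) (x 0) * Real.exp (ψ t)) :
    IsGAS S f := by
  obtain ⟨-, hlomono, hlo0, -⟩ := hlo
  obtain ⟨hhic, hhimono, hhi0, -⟩ := hhi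
  have hlo_pos : ∀ ε : ℝ, 0 < ε → 0 < lo ε := fun ε hε ↦
    hlo0 ▸ hlomono self_mem_Ici hε.le hε
  have hbound : ∀ x, IsSolution S f x → ∀ t, 0 ≤ t →
      lo ‖x t‖ ≤ hi ‖x 0‖ * Real.exp (ψ t) := fun x hx t ht ↦
    (hV _ _).1.trans ((h x hx t ht).trans (by gcongr; exact (hV _ _).2))
  refine ⟨fun ε hε ↦ ?_, fun x hx ↦ ?_⟩
  · have hlim : Tendsto (fun r ↦ hi r * Real.exp M) (nhdsWithin 0 (Ici 0)) (nhds 0) := by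
      have := (hhic 0 self_mem_Ici).tendsto.mul_const (Real.exp M)
      rwa [hhi0, zero_mul] at this
    obtain ⟨δ, hδ, hδ'⟩ := Metric.mem_nhdsWithin_iff.1 (hlim.eventually_lt_const (hlo_pos ε hε))
    refine ⟨δ, hδ, fun x hx hx0 t ht ↦ ?_⟩
    have hhi_nonneg : 0 ≤ hi ‖x 0‖ :=
      hhi0.symm.trans_le <| hhimono.monotoneOn self_mem_Ici (norm_nonneg (x 0)) (norm_nonneg (x 0))
    have hsmall : hi ‖x 0‖ * Real.exp M < lo ε := hδ' ⟨by simpa using hx0, norm_nonneg (x 0)⟩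
    refine (hlomono.lt_iff_lt (norm_nonneg (x t)) hε.le).1 ?_
    calc lo ‖x t‖ ≤ hi ‖x 0‖ * Real.exp (ψ t) := hbound x hx t ht
      _ ≤ hi ‖x 0‖ * Real.exp M := by gcongr; exact hM t ht
      _ < lo ε := hsmall
  · rw [tendsto_zero_iff_norm_tendsto_zero, Metric.tendsto_nhds]
    intro ε hε
    have hlim : Tendsto (fun t ↦ hi ‖x 0‖ * Real.exp (ψ t)) atTop (nhds 0) := by
      simpa using (Real.tendsto_exp_atBot.comp hψ).const_mul (hi ‖x 0‖)
    filter_upwards [hlim.eventually_lt_const (hlo_pos ε hε), eventually_ge_atTop 0] with t ht ht0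
    have := (hlomono.lt_iff_lt (norm_nonneg (x t)) hε.le).1 ((hbound x hx t ht0).trans_lt ht)
    simpa using this

end Lyapunov

theorem stmt0 {d : ℕ} {P : Type*}
    (S : SwitchSig P)
    (f : P → EuclideanSpace ℝ (Fin d) → EuclideanSpace ℝ (Fin d))
    (PS PU : Finset P) (Eadm : Finset (P × P))
    (V : P → EuclideanSpace ℝ (Fin d) → ℝ) (lam : P → ℝ) (mu : P → P → ℝ)
    (lo hi : ℝ → ℝ)
    (hcover : ∀ i : P, i ∈ PS ∨ i ∈ PU) (hdisj : Disjoint PS PU)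
    (hLip : ∀ i : P, ∃ K : NNReal, LipschitzWith K (f i))
    (hzero : ∀ i : P, f i 0 = 0)
    (hadm : ∀ i : ℕ, (S.sig (S.tau i), S.sig (S.tau (i + 1))) ∈ Eadm)
    (h1 : Assumption1 f V lam PS PU lo hi)
    (h2 : Assumption2 V mu Eadm)
    (hcond : Filter.limsup
        (fun t : ℝ =>
          ((S.nu t * ∑ p ∈ Eadm, Real.log (mu p.1 p.2) * S.rho p.1 p.2 t
              - ∑ j ∈ PS, |lam j| * S.eta j t
              + ∑ k ∈ PU, |lam k| * S.eta k t : ℝ) : EReal))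
        Filter.atTop < (0 : EReal)) :
    IsGAS S f := by
  obtain ⟨hlo, hhi, -, -, hPS, hPU, hsand, hdecay⟩ := h1
  have hQ : ∀ i, i ∈ PS.disjUnion PU hdisj := fun i ↦ Finset.mem_disjUnion.2 (hcover i)
  have hrate : ∀ t : ℝ, S.nu t * ∑ p ∈ Eadm, Real.log (mu p.1 p.2) * S.rho p.1 p.2 t
      - ∑ j ∈ PS, |lam j| * S.eta j t + ∑ k ∈ PU, |lam k| * S.eta k t =
        S.exponent lam mu (PS.disjUnion PU hdisj) Eadm t / t := by
    intro t
    have hE : S.nu t * ∑ p ∈ Eadm, Real.log (mu p.1 p.2) * S.rho p.1 p.2 t =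
        (∑ p ∈ Eadm, Real.log (mu p.1 p.2) * S.Ntrans p.1 p.2 t) / t := by
      rw [Finset.mul_sum, Finset.sum_div]
      refine Finset.sum_congr rfl fun p _ ↦ ?_
      rw [mul_left_comm, S.nu_mul_rho, mul_div_assoc]
    have hS : ∑ j ∈ PS, |lam j| * S.eta j t = (∑ j ∈ PS, lam j * S.T j 0 t) / t := by
      rw [Finset.sum_div]
      refine Finset.sum_congr rfl fun j hj ↦ ?_
      rw [abs_of_pos (hPS j hj), SwitchSig.eta, mul_div_assoc]
    have hU : ∑ k ∈ PU, |lam k| * S.eta k t = -(∑ k ∈ PU, lam k * S.T k 0 t) / t := by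
      rw [← Finset.sum_neg_distrib, Finset.sum_div]
      refine Finset.sum_congr rfl fun k hk ↦ ?_
      rw [abs_of_neg (hPU k hk), SwitchSig.eta, ← mul_div_assoc, neg_mul]
    rw [hE, hS, hU, SwitchSig.exponent, Finset.sum_disjUnion]
    ring
  obtain ⟨c, hc, hc0⟩ := EReal.lt_iff_exists_real_btwn.1 hcond
  have hc0 : c < 0 := EReal.coe_lt_coe_iff.1 hc0
  have hdec : ∀ᶠ t in atTop, S.exponent lam mu (PS.disjUnion PU hdisj) Eadm t ≤ c * t := by
    filter_upwards [eventually_lt_of_limsup_lt hc, eventually_gt_atTop 0] with t ht ht0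
    rw [EReal.coe_lt_coe_iff, hrate, div_lt_iff₀ ht0] at ht
    exact ht.le
  have hlim : Tendsto (S.exponent lam mu (PS.disjUnion PU hdisj) Eadm) atTop atBot :=
    tendsto_atBot_mono' _ hdec (tendsto_id.const_mul_atTop_of_neg hc0)
  obtain ⟨t₀, ht₀⟩ := eventually_atTop.1 (hlim.eventually_le_atBot 0)
  refine isGAS_of_lyapunov_le hlo hhi hsand
    (M := max 0 (∑ p ∈ Eadm, Real.log (mu p.1 p.2) * S.Ntrans p.1 p.2 t₀
      + ∑ j ∈ PS.disjUnion PU hdisj, |lam j| * t₀))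
    (fun t ht ↦ ?_) hlim fun x hx t ht ↦ hx.lyapunov_le hQ hLip hadm hdecay h2 ht
  rcases le_total t₀ t with htt | htt
  · exact (ht₀ t htt).trans (le_max_left _ _)
  · exact (S.exponent_le_of_le lam mu (fun p hp ↦ (h2 p hp).1) ht htt).trans (le_max_right _ _)
end
end

section
/- Suppose P_U = ∅ and μ_{ij} = μ_j for all (i,j) ∈ E(P), i.e., the constant of Assumption 2 depends only on the destination subsystem j. If the switching signal σ satisfies mode-dependent average dwell times, i.e., for every j ∈ P there exist N_0^j > 0 and τ_a^j > 0 with N_j(s,t) ≤ N_0^j + T_j(s,t)/τ_a^j for every 0 ≤ s < t, and τ_a^j > (ln μ_j)/λ_j for every j ∈ P, then the switched system ẋ(t) = f_{σ(t)}(x(t)) is globally asymptotically stable under σ. -/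
open Filter MeasureTheory Set

noncomputable section

theorem exists_hasDerivAt_Ioo_of_lipschitzWith {E : Type*} [NormedAddCommGroup E]
    [NormedSpace ℝ E] [CompleteSpace E] {g : E → E} {K : NNReal} (hg : LipschitzWith K g)
    (h0 : g 0 = 0) (y : E) :
    ∃ γ : ℝ → E, γ 0 = y ∧
      ∀ t ∈ Ioo (-(1 / (2 * K + 1 : ℝ))) (1 / (2 * K + 1 : ℝ)), HasDerivAt γ (g (γ t)) t := by
  set T : ℝ := 1 / (2 * K + 1 : ℝ) with hT
  have hTpos : 0 < T := by positivity
  have hKT : 2 * K * T ≤ 1 := by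
    rw [hT, mul_one_div, div_le_one (by positivity)]
    linarith
  have hpl : IsPicardLindelof (fun _ : ℝ => g) (tmin := -T) (tmax := T)
      ⟨0, by constructor <;> linarith⟩ y (‖y‖₊ + 1) 0 (K * (2 * (‖y‖₊ + 1))) K := by
    refine .of_time_independent (fun x hx => ?_) hg.lipschitzOnWith ?_
    · have h1 : ‖g x‖ ≤ K * ‖x‖ := by
        simpa [h0] using hg.dist_le_mul x 0
      have h2 : ‖x‖ ≤ 2 * (‖y‖ + 1) := by
        have h3 : ‖x - y‖ ≤ ‖y‖ + 1 := by simpa [dist_eq_norm] using hx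
        have h4 := norm_le_norm_add_norm_sub' x y
        linarith [norm_nonneg y]
      refine h1.trans ?_
      push_cast
      exact mul_le_mul_of_nonneg_left h2 K.2
    · push_cast
      simp only [sub_zero, zero_sub, neg_neg, max_self]
      nlinarith [norm_nonneg y]
  obtain ⟨γ, hγ0, hγ⟩ := hpl.exists_eq_forall_mem_Icc_hasDerivWithinAt₀
  exact ⟨γ, hγ0, fun t ht =>
    (hγ t (Ioo_subset_Icc_self ht)).hasDerivAt (Icc_mem_nhds ht.1 ht.2)⟩

theorem exists_forall_hasDerivAt_of_lipschitzWith {E : Type*} [NormedAddCommGroup E]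
    [NormedSpace ℝ E] [CompleteSpace E] {g : E → E} {K : NNReal} (hg : LipschitzWith K g)
    (h0 : g 0 = 0) (y : E) :
    ∃ γ : ℝ → E, γ 0 = y ∧ ∀ t : ℝ, 0 ≤ t → HasDerivAt γ (g (γ t)) t := by
  choose φ hφ0 hφ using exists_hasDerivAt_Ioo_of_lipschitzWith hg h0
  obtain ⟨h, hh, hT⟩ : ∃ h : ℝ, 0 < h ∧ 1 / (2 * K + 1 : ℝ) = 2 * h :=
    ⟨1 / (2 * K + 1) / 2, by positivity, by ring⟩
  rw [hT] at hφ
  let z : ℕ → E := fun n => (fun w => φ w h)^[n] y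
  have hz : ∀ n, z (n + 1) = φ (z n) h := fun n => Function.iterate_succ_apply' _ _ _
  have hglue : ∀ n, EqOn (φ (z (n + 1))) (fun s => φ (z n) (s + h)) (Ioo (-(2 * h)) h) := by
    intro n
    refine ODE_solution_unique_of_mem_Ioo (v := fun _ => g) (s := fun _ => univ) (K := K)
      (t₀ := 0) (fun _ _ => hg.lipschitzOnWith) ⟨by linarith, hh⟩
      (fun t ht => ⟨hφ _ t ⟨ht.1, by linarith [ht.2]⟩, mem_univ _⟩)
      (fun t ht => ⟨?_, mem_univ _⟩) ?_
    · exact (hφ (z n) (t + h) ⟨by linarith [ht.1], by linarith [ht.2]⟩).comp_add_const t h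
    · rw [hφ0, hz, zero_add]
  have hfloor : ∀ (n : ℕ) (s : ℝ), n * h ≤ s → s < (n + 1) * h → ⌊s / h⌋₊ = n := by
    intro n s hs hs'
    have h1 : (n : ℝ) ≤ s / h := by rwa [le_div_iff₀ hh]
    rw [Nat.floor_eq_iff (n.cast_nonneg.trans h1)]
    exact ⟨h1, by rwa [div_lt_iff₀ hh]⟩
  let Γ : ℝ → E := fun t => φ (z ⌊t / h⌋₊) (t - ⌊t / h⌋₊ * h)
  have hΓ : ∀ (n : ℕ) (s : ℝ), (n - 1) * h < s → s < (n + 1) * h →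
      Γ s = φ (z n) (s - n * h) := by
    intro n s hs hs'
    by_cases hns : n * h ≤ s
    · simp only [Γ, hfloor n s hns hs']
    · push Not at hns
      cases n with
      | zero =>
        have h1 : ⌊s / h⌋₊ = 0 := Nat.floor_of_nonpos
          (div_nonpos_of_nonpos_of_nonneg (by simpa using hns.le) hh.le)
        simp only [Γ, h1]
      | succ m =>
        push_cast at hs hs' hns
        have h1 : ⌊s / h⌋₊ = m := hfloor m s (by linarith) hns
        have h2 := hglue m (x := s - (m + 1) * h) ⟨by linarith, by linarith⟩
        simp only [Γ, h1]
        push_cast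
        rw [h2]
        congr 1
        ring
  refine ⟨Γ, by simp [Γ, z, hφ0], fun t ht => ?_⟩
  set n := ⌊t / h⌋₊ with hn
  have h1 : n * h ≤ t := by
    rw [← le_div_iff₀ hh]
    exact Nat.floor_le (by positivity)
  have h2 : t < (n + 1) * h := by
    rw [← div_lt_iff₀ hh]
    exact Nat.lt_floor_add_one _
  have h3 : HasDerivAt (fun s => φ (z n) (s - n * h)) (g (φ (z n) (t - n * h))) t :=
    (hφ (z n) (t - n * h) ⟨by linarith, by linarith⟩).comp_sub_const t (n * h)
  rw [hΓ n t (by linarith) h2]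
  refine h3.congr_of_eventuallyEq ?_
  filter_upwards [Ioo_mem_nhds (show (n - 1) * h < t by linarith) h2] with s hs
  exact hΓ n s hs.1 hs.2

/-- A decay estimate valid along all forward-complete trajectories of `y' = g y` also holds along
trajectories defined on a bounded interval only. -/
theorem decay_on_Icc_of_decay_on_Ici {E : Type*} [NormedAddCommGroup E]
    [NormedSpace ℝ E] [CompleteSpace E] {g : E → E} {K : NNReal} (hg : LipschitzWith K g)
    (h0 : g 0 = 0) {W : E → ℝ} (hW : Continuous W) {c : ℝ}
    (hdecay : ∀ γ : ℝ → E, ContinuousOn γ (Ici (0 : ℝ)) →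
      (∀ t : ℝ, 0 < t → HasDerivAt γ (g (γ t)) t) →
      ∀ t : ℝ, 0 ≤ t → W (γ t) ≤ W (γ 0) * Real.exp (-c * t))
    {x : ℝ → E} {a b : ℝ} (hx : ContinuousOn x (Icc a b))
    (hx' : ∀ t ∈ Ioo a b, HasDerivAt x (g (x t)) t) {t : ℝ} (ht : t ∈ Icc a b) :
    W (x t) ≤ W (x a) * Real.exp (-c * (t - a)) := by
  rcases ht.1.eq_or_lt with rfl | hat
  · simp
  have hab : a < b := hat.trans_le ht.2
  have key : ∀ s ∈ Ioo a b, ∀ r ∈ Ico s b, W (x r) ≤ W (x s) * Real.exp (-c * (r - s)) := by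
    intro s hs r hr
    obtain ⟨γ, hγ0, hγ⟩ := exists_forall_hasDerivAt_of_lipschitzWith hg h0 (x s)
    have heq : EqOn γ (fun u => x (u + s)) (Icc 0 (r - s)) := by
      have hmem : ∀ u ∈ Icc 0 (r - s), u + s ∈ Ioo a b := fun u hu =>
        ⟨by linarith [hu.1, hs.1], by linarith [hu.2, hr.2]⟩
      have hd : ∀ u ∈ Icc 0 (r - s), HasDerivAt (fun u => x (u + s)) (g (x (u + s))) u :=
        fun u hu => (hx' _ (hmem u hu)).comp_add_const u s
      refine ODE_solution_unique_of_mem_Icc_right (v := fun _ => g) (s := fun _ => univ)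
        (K := K) (fun _ _ => hg.lipschitzOnWith)
        (HasDerivAt.continuousOn fun u hu => hγ u hu.1)
        (fun u hu => (hγ u hu.1).hasDerivWithinAt) (fun _ _ => mem_univ _)
        (HasDerivAt.continuousOn fun u hu => hd u hu)
        (fun u hu => (hd u (Ico_subset_Icc_self hu)).hasDerivWithinAt) (fun _ _ => mem_univ _)
        (by simp [hγ0])
    have h1 := hdecay γ (HasDerivAt.continuousOn fun u hu => hγ u hu) (fun u hu => hγ u hu.le)
      (r - s) (sub_nonneg.2 hr.1)
    rw [heq ⟨sub_nonneg.2 hr.1, le_rfl⟩, hγ0] at h1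
    simpa only [sub_add_cancel] using h1
  have hWx : ContinuousOn (fun r => W (x r)) (Icc a b) := hW.comp_continuousOn hx
  have key2 : ∀ r ∈ Ioo a b, W (x r) ≤ W (x a) * Real.exp (-c * (r - a)) := by
    intro r hr
    have hlim : Tendsto (fun s => W (x s) * Real.exp (-c * (r - s))) (nhdsWithin a (Ioo a r))
        (nhds (W (x a) * Real.exp (-c * (r - a)))) := by
      refine Tendsto.mul ((hWx a ⟨le_rfl, hab.le⟩).mono_left (nhdsWithin_mono _ ?_)) ?_
      · exact fun s hs => ⟨hs.1.le, hs.2.le.trans hr.2.le⟩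
      · exact ((by fun_prop : Continuous fun s => Real.exp (-c * (r - s))).tendsto a).mono_left
          nhdsWithin_le_nhds
    have : (nhdsWithin a (Ioo a r)).NeBot := left_nhdsWithin_Ioo_neBot hr.1
    refine ge_of_tendsto hlim ?_
    filter_upwards [self_mem_nhdsWithin] with s hs
    exact key s ⟨hs.1, hs.2.trans hr.2⟩ r ⟨hs.2.le, hr.2⟩
  have hclos : closure (Ioo a b) = Icc a b := closure_Ioo hab.ne
  have hexp : ContinuousOn (fun r => W (x a) * Real.exp (-c * (r - a))) (Icc a b) := by
    fun_prop
  exact le_on_closure (s := Ioo a b) key2 (hclos ▸ hWx) (hclos ▸ hexp) (hclos ▸ ht)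

namespace SwitchSig

variable {P : Type*} (S : SwitchSig P)

theorem exists_mem_Ico {t : ℝ} (ht : 0 ≤ t) : ∃ n, t ∈ Ico (S.tau n) (S.tau (n + 1)) := by
  obtain ⟨m, hm⟩ := (S.tends.eventually_gt_atTop t).exists
  classical
  have hex : ∃ m, t < S.tau m := ⟨m, hm⟩
  obtain ⟨n, hn⟩ : ∃ n, Nat.find hex = n + 1 := Nat.exists_eq_succ_of_ne_zero fun h0 => by
    have := Nat.find_spec hex
    rw [h0, S.tau0] at this
    linarith
  exact ⟨n, not_lt.1 (Nat.find_min hex (by omega)), hn ▸ Nat.find_spec hex⟩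

open scoped Classical in
theorem card_filter_le_Nmode (j : P) (n : ℕ) :
    ((Finset.range n).filter fun i => S.sig (S.tau (i + 1)) = j).card
      ≤ S.Nmode j 0 (S.tau n) := by
  have hfin : {i : ℕ | 0 < S.tau i ∧ S.tau i ≤ S.tau n ∧ S.sig (S.tau i) = j}.Finite :=
    (finite_Iic n).subset fun i hi => S.mono.le_iff_le.1 hi.2.1
  rw [Nmode, ← Finset.card_image_of_injective _ (add_left_injective 1), ← ncard_coe_finset]
  refine ncard_le_ncard ?_ hfin
  intro k hk
  simp only [Finset.coe_image, Finset.coe_filter, Finset.mem_range, mem_image,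
    mem_ofPred_eq] at hk
  obtain ⟨i, ⟨hin, hij⟩, rfl⟩ := hk
  exact ⟨(S.tau_nonneg i).trans_lt (S.mono i.lt_succ_self), S.mono.monotone hin, hij⟩

open scoped Classical in
theorem T_le_sum (j : P) (n : ℕ) :
    S.T j 0 (S.tau n) ≤
      ∑ i ∈ (Finset.range n).filter (fun i => S.sig (S.tau i) = j),
        (S.tau (i + 1) - S.tau i) := by
  have hnn : ∀ i, 0 ≤ S.tau (i + 1) - S.tau i := fun i =>
    sub_nonneg.2 (S.mono i.lt_succ_self).le
  have hsub : {r : ℝ | 0 < r ∧ r ≤ S.tau n ∧ S.sig r = j} ⊆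
      (⋃ i ∈ (Finset.range n).filter (fun i => S.sig (S.tau i) = j),
        Icc (S.tau i) (S.tau (i + 1))) ∪ {S.tau n} := by
    rintro r ⟨hr0, hrn, hrj⟩
    rcases hrn.eq_or_lt with rfl | hlt
    · exact Or.inr rfl
    obtain ⟨i, hi⟩ := S.exists_mem_Ico hr0.le
    refine Or.inl (mem_iUnion₂.2 ⟨i, ?_, Ico_subset_Icc_self hi⟩)
    rw [Finset.mem_filter, Finset.mem_range]
    exact ⟨S.mono.lt_iff_lt.1 (hi.1.trans_lt hlt), by rw [← S.const i r hi.1 hi.2, hrj]⟩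
  have hvol : volume {r : ℝ | 0 < r ∧ r ≤ S.tau n ∧ S.sig r = j} ≤
      ENNReal.ofReal (∑ i ∈ (Finset.range n).filter (fun i => S.sig (S.tau i) = j),
        (S.tau (i + 1) - S.tau i)) := by
    refine (measure_mono hsub).trans ((measure_union_le _ _).trans ?_)
    rw [Real.volume_singleton, add_zero, ENNReal.ofReal_sum_of_nonneg fun i _ => hnn i]
    refine (measure_biUnion_finset_le _ _).trans (le_of_eq ?_)
    simp only [Real.volume_Icc]
  exact ENNReal.toReal_le_of_le_ofReal (Finset.sum_nonneg fun i _ => hnn i) hvol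

end SwitchSig

/-- Under mode-dependent average dwell times, the accumulated logarithmic gain at the switching
instants decreases at least linearly in time. -/
theorem exists_sum_gain_le {P : Type*} [Fintype P] (S : SwitchSig P) {l lam N0 taua : P → ℝ}
    (hl : ∀ j, 0 ≤ l j) (htaua : ∀ j, 0 < taua j) (hN0 : ∀ j, 0 < N0 j)
    (hN : ∀ j : P, ∀ s t : ℝ, 0 ≤ s → s < t →
      (S.Nmode j s t : ℝ) ≤ N0 j + S.T j s t / taua j)
    (hlt : ∀ j, l j / taua j < lam j) :
    ∃ C c : ℝ, 0 < c ∧ ∀ n : ℕ,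
      ∑ i ∈ Finset.range n, (l (S.sig (S.tau (i + 1))) -
        lam (S.sig (S.tau i)) * (S.tau (i + 1) - S.tau i)) ≤ C - c * S.tau n := by
  classical
  have : Nonempty P := ⟨S.sig 0⟩
  obtain ⟨j₀, hj₀⟩ := Finite.exists_min fun j => lam j - l j / taua j
  refine ⟨∑ j, l j * N0 j, lam j₀ - l j₀ / taua j₀, sub_pos.2 (hlt j₀), fun n => ?_⟩
  set c := lam j₀ - l j₀ / taua j₀
  rcases n.eq_zero_or_pos with rfl | hn
  · simpa [S.tau0] using Finset.sum_nonneg fun j _ => mul_nonneg (hl j) (hN0 j).le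
  let D : P → ℝ := fun j => ∑ i ∈ (Finset.range n).filter (fun i => S.sig (S.tau i) = j),
    (S.tau (i + 1) - S.tau i)
  have hD0 : ∀ j, 0 ≤ D j := fun j => Finset.sum_nonneg fun i _ =>
    sub_nonneg.2 (S.mono i.lt_succ_self).le
  have hDsum : ∑ j, D j = S.tau n := by
    refine (Finset.sum_fiberwise (Finset.range n) (fun i => S.sig (S.tau i)) _).trans ?_
    rw [Finset.sum_range_sub, S.tau0, sub_zero]
  have hlamsum : ∑ i ∈ Finset.range n, lam (S.sig (S.tau i)) * (S.tau (i + 1) - S.tau i) =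
      ∑ j, lam j * D j := by
    rw [← Finset.sum_fiberwise (Finset.range n) (fun i => S.sig (S.tau i))]
    refine Finset.sum_congr rfl fun j _ => ?_
    rw [Finset.mul_sum]
    exact Finset.sum_congr rfl fun i hi => by rw [(Finset.mem_filter.1 hi).2]
  have hlsum : ∑ i ∈ Finset.range n, l (S.sig (S.tau (i + 1))) =
      ∑ j, l j * ((Finset.range n).filter fun i => S.sig (S.tau (i + 1)) = j).card := by
    rw [← Finset.sum_fiberwise (Finset.range n) (fun i => S.sig (S.tau (i + 1)))]
    refine Finset.sum_congr rfl fun j _ => ?_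
    rw [mul_comm, ← nsmul_eq_mul, ← Finset.sum_const]
    exact Finset.sum_congr rfl fun i hi => by rw [(Finset.mem_filter.1 hi).2]
  have hmode : ∀ j, l j * ((Finset.range n).filter fun i => S.sig (S.tau (i + 1)) = j).card -
      lam j * D j ≤ l j * N0 j - c * D j := by
    intro j
    have h1 : (((Finset.range n).filter fun i => S.sig (S.tau (i + 1)) = j).card : ℝ) ≤
        N0 j + D j / taua j := by
      calc _ ≤ (S.Nmode j 0 (S.tau n) : ℝ) := by exact_mod_cast S.card_filter_le_Nmode j n
        _ ≤ N0 j + S.T j 0 (S.tau n) / taua j :=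
          hN j 0 _ le_rfl (S.tau0 ▸ S.mono hn)
        _ ≤ N0 j + D j / taua j :=
          add_le_add_right (div_le_div_of_nonneg_right (S.T_le_sum j n) (htaua j).le) _
    have h2 := mul_le_mul_of_nonneg_left h1 (hl j)
    have h3 := mul_le_mul_of_nonneg_right (hj₀ j) (hD0 j)
    have h4 : l j * (N0 j + D j / taua j) = l j * N0 j + l j / taua j * D j := by ring
    change c * D j ≤ (lam j - l j / taua j) * D j at h3
    linarith
  rw [Finset.sum_sub_distrib, hlsum, hlamsum, ← Finset.sum_sub_distrib, ← hDsum, Finset.mul_sum,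
    ← Finset.sum_sub_distrib]
  exact Finset.sum_le_sum fun j _ => hmode j

/-- If `lo ‖x t‖` is bounded by `hi ‖x 0‖` up to a factor that is bounded and tends to zero,
uniformly in the solution `x`, then the switched system is globally asymptotically stable. -/
theorem isGAS_of_le {P : Type*} {E : Type*} [NormedAddCommGroup E] [NormedSpace ℝ E]
    {S : SwitchSig P} {f : P → E → E} {lo hi : ℝ → ℝ} (hlo : ClassKInf lo) (hhi : ClassKInf hi)
    {C : ℝ} {b : ℕ → ℝ} (hbC : ∀ n, b n ≤ C) (hb : Tendsto b atTop (nhds 0))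
    (hle : ∀ x : ℝ → E, IsSolution S f x → ∀ n : ℕ,
      ∀ t ∈ Ico (S.tau n) (S.tau (n + 1)), lo ‖x t‖ ≤ hi ‖x 0‖ * b n) :
    IsGAS S f := by
  have hlo_lt : ∀ {ε : ℝ}, 0 < ε → ∀ v : E, lo ‖v‖ < lo ε → ‖v‖ < ε := fun hε v hv =>
    (hlo.2.1.lt_iff_lt (norm_nonneg v) hε.le).1 hv
  have hlo_pos : ∀ {ε : ℝ}, 0 < ε → 0 < lo ε := fun {ε} hε => by
    have := hlo.2.1 (mem_Ici.2 le_rfl) (mem_Ici.2 hε.le) hε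
    rwa [hlo.2.2.1] at this
  have hhi_nonneg : ∀ v : E, 0 ≤ hi ‖v‖ := fun v => by
    have := hhi.2.1.monotoneOn (mem_Ici.2 le_rfl) (mem_Ici.2 (norm_nonneg v)) (norm_nonneg v)
    rwa [hhi.2.2.1] at this
  refine ⟨fun ε hε => ?_, fun x hx => ?_⟩
  · have hlim : Tendsto (fun r => hi r * C) (nhdsWithin 0 (Ici 0)) (nhds 0) := by
      have h1 := (hhi.1 0 (mem_Ici.2 le_rfl)).tendsto.mul_const C
      rwa [hhi.2.2.1, zero_mul] at h1
    obtain ⟨δ, hδ, hδ'⟩ := Metric.mem_nhdsWithin_iff.1 (hlim.eventually_lt_const (hlo_pos hε))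
    refine ⟨δ, hδ, fun x hx hx0 t ht => hlo_lt hε _ ?_⟩
    obtain ⟨n, hn⟩ := S.exists_mem_Ico ht
    refine (hle x hx n t hn).trans_lt ?_
    refine (mul_le_mul_of_nonneg_left (hbC n) (hhi_nonneg _)).trans_lt ?_
    exact hδ' ⟨by simpa using hx0, norm_nonneg _⟩
  · rw [Metric.tendsto_atTop]
    intro ε hε
    have hlim : Tendsto (fun n => hi ‖x 0‖ * b n) atTop (nhds 0) := by
      simpa using hb.const_mul (hi ‖x 0‖)
    obtain ⟨m, hm⟩ := eventually_atTop.1 (hlim.eventually_lt_const (hlo_pos hε))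
    refine ⟨S.tau m, fun t ht => ?_⟩
    obtain ⟨n, hn⟩ := S.exists_mem_Ico ((S.tau_nonneg m).trans ht)
    rw [dist_zero_right]
    refine hlo_lt hε _ ((hle x hx n t hn).trans_lt (hm n ?_))
    exact Nat.lt_succ_iff.1 (S.mono.lt_iff_lt.1 (ht.trans_lt hn.2))

theorem stmt2 {d : ℕ} {P : Type*} [Fintype P]
    (S : SwitchSig P)
    (f : P → EuclideanSpace ℝ (Fin d) → EuclideanSpace ℝ (Fin d))
    (Eadm : Finset (P × P))
    (V : P → EuclideanSpace ℝ (Fin d) → ℝ) (lam : P → ℝ) (mu : P → P → ℝ)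
    (mud : P → ℝ) (lo hi : ℝ → ℝ)
    (hLip : ∀ i : P, ∃ K : NNReal, LipschitzWith K (f i))
    (hzero : ∀ i : P, f i 0 = 0)
    (hadm : ∀ i : ℕ, (S.sig (S.tau i), S.sig (S.tau (i + 1))) ∈ Eadm)
    -- `P_U = ∅` : all subsystems are stable
    (h1 : Assumption1 f V lam Finset.univ ∅ lo hi)
    (h2 : Assumption2 V mu Eadm)
    -- the constant of Assumption 2 depends only on the destination subsystem
    (hmud : ∀ p ∈ Eadm, mu p.1 p.2 = mud p.2)
    (N0 taua : P → ℝ) (hN0 : ∀ j : P, 0 < N0 j) (htaua : ∀ j : P, 0 < taua j)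
    (hmdADT : ∀ j : P, ∀ s t : ℝ, 0 ≤ s → s < t →
        (S.Nmode j s t : ℝ) ≤ N0 j + S.T j s t / taua j)
    (htbig : ∀ j : P, Real.log (mud j) / lam j < taua j) :
    IsGAS S f := by
  obtain ⟨hlo, hhi, hVc, hV0, hlam, -, hV, hdec⟩ := h1
  have hlam' : ∀ j, 0 < lam j := fun j => hlam j (Finset.mem_univ j)
  have hdecay : ∀ x, IsSolution S f x → ∀ n, ∀ t ∈ Icc (S.tau n) (S.tau (n + 1)),
      V (S.sig (S.tau n)) (x t) ≤ V (S.sig (S.tau n)) (x (S.tau n)) *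
        Real.exp (-(lam (S.sig (S.tau n))) * (t - S.tau n)) := by
    intro x hx n t ht
    obtain ⟨K, hK⟩ := hLip (S.sig (S.tau n))
    refine decay_on_Icc_of_decay_on_Ici hK (hzero _) (hVc _).continuous (hdec _)
      (hx.1.mono fun s hs => (S.tau_nonneg n).trans hs.1) (fun s hs => ?_) ht
    rw [← S.const n s hs.1.le hs.2]
    exact hx.2 n s hs.1 hs.2
  let l : P → ℝ := fun j => max 0 (Real.log (mud j))
  have hl : ∀ j, 0 ≤ l j := fun j => le_max_left _ _
  have hllam : ∀ j, l j / taua j < lam j := fun j => by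
    rw [div_lt_iff₀ (htaua j)]
    refine max_lt (mul_pos (hlam' j) (htaua j)) ?_
    rw [mul_comm]
    exact (div_lt_iff₀ (hlam' j)).1 (htbig j)
  have hjump : ∀ n ξ, V (S.sig (S.tau (n + 1))) ξ ≤
      Real.exp (l (S.sig (S.tau (n + 1)))) * V (S.sig (S.tau n)) ξ := by
    intro n ξ
    obtain ⟨hmu1, hmu⟩ := h2 _ (hadm n)
    rw [hmud _ (hadm n)] at hmu1 hmu
    refine (hmu ξ).trans (mul_le_mul_of_nonneg_right ?_ (hV0 _ _))
    rw [← Real.log_le_iff_le_exp (zero_lt_one.trans_le hmu1)]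
    exact le_max_right _ _
  obtain ⟨C, c, hc, hgain⟩ := exists_sum_gain_le S hl htaua hN0 hmdADT hllam
  let a : ℕ → ℝ := fun n => ∑ i ∈ Finset.range n, (l (S.sig (S.tau (i + 1))) -
    lam (S.sig (S.tau i)) * (S.tau (i + 1) - S.tau i))
  have hinst : ∀ x, IsSolution S f x → ∀ n, V (S.sig (S.tau n)) (x (S.tau n)) ≤
      V (S.sig 0) (x 0) * Real.exp (a n) := by
    intro x hx n
    induction n with
    | zero => simp [a, S.tau0]
    | succ n ih =>
      have hle : S.tau n ≤ S.tau (n + 1) := (S.mono n.lt_succ_self).le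
      refine (hjump n _).trans ?_
      have h1 := (hdecay x hx n _ ⟨hle, le_rfl⟩).trans
        (mul_le_mul_of_nonneg_right ih (Real.exp_nonneg _))
      refine (mul_le_mul_of_nonneg_left h1 (Real.exp_nonneg _)).trans (le_of_eq ?_)
      have h3 : a (n + 1) = l (S.sig (S.tau (n + 1))) + (a n +
          -(lam (S.sig (S.tau n))) * (S.tau (n + 1) - S.tau n)) := by
        simp only [a, Finset.sum_range_succ]
        ring
      rw [h3, Real.exp_add, Real.exp_add]
      ring
  refine isGAS_of_le hlo hhi (C := Real.exp C) (b := fun n => Real.exp (C - c * S.tau n))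
    (fun n => ?_) ?_ fun x hx n t ht => ?_
  · exact Real.exp_le_exp.2 (sub_le_self _ (mul_nonneg hc.le (S.tau_nonneg n)))
  · refine Real.tendsto_exp_atBot.comp ?_
    exact tendsto_const_nhds.add_atBot
      (tendsto_neg_atTop_atBot.comp (S.tends.const_mul_atTop hc))
  · calc lo ‖x t‖ ≤ V (S.sig (S.tau n)) (x t) := (hV _ _).1
      _ ≤ V (S.sig (S.tau n)) (x (S.tau n)) := by
        refine (hdecay x hx n t (Ico_subset_Icc_self ht)).trans
          (mul_le_of_le_one_right (hV0 _ _) (Real.exp_le_one_iff.2 ?_))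
        exact mul_nonpos_of_nonpos_of_nonneg (neg_nonpos.2 (hlam' _).le) (sub_nonneg.2 ht.1)
      _ ≤ V (S.sig 0) (x 0) * Real.exp (a n) := hinst x hx n
      _ ≤ hi ‖x 0‖ * Real.exp (C - c * S.tau n) :=
        mul_le_mul (hV _ _).2 (Real.exp_le_exp.2 (hgain n)) (Real.exp_nonneg _)
          ((hV0 _ _).trans (hV (S.sig 0) _).2)
end
end

section
/- Under Assumptions 1 and 2, if the switching signal σ satisfies limsup_{t→+∞} ν(t) < +∞ and (limsup_{t→+∞} ν(t)) · Σ_{(k,ℓ)∈E(P)} (ln μ_{kℓ}) · limsup_{t→+∞} ρ_{kℓ}(t) < Σ_{j∈P_S} |λ_j| · liminf_{t→+∞} η_j(t) − Σ_{k∈P_U} |λ_k| · limsup_{t→+∞} η_k(t), then the switched system ẋ(t) = f_{σ(t)}(x(t)) is globally asymptotically stable under σ. -/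
open Filter MeasureTheory Set

noncomputable section

section GlobalExistence

variable {E : Type*} [NormedAddCommGroup E] [NormedSpace ℝ E]

/-- `γ` is continuous on `[a, b]` and solves `γ' = v γ` on `(a, b)`. -/
def SolvesOn (v : E → E) (γ : ℝ → E) (a b : ℝ) : Prop :=
  ContinuousOn γ (Icc a b) ∧ ∀ t ∈ Ioo a b, HasDerivAt γ (v (γ t)) t

variable {v : E → E} {γ φ : ℝ → E} {a b c : ℝ}

theorem SolvesOn.hasDerivWithinAt_Iic (hv : Continuous v) (hγ : SolvesOn v γ a b) (hab : a < b) :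
    HasDerivWithinAt γ (v (γ b)) (Iic b) b := by
  have hmem : Ioo a b ∈ nhdsWithin b (Iio b) := Ioo_mem_nhdsLT hab
  have hlim : Tendsto γ (nhdsWithin b (Iio b)) (nhds (γ b)) :=
    ((hγ.1 b (right_mem_Icc.2 hab.le)).mono Ioo_subset_Icc_self).mono_left
      (nhdsWithin_le_iff.2 hmem)
  refine hasDerivWithinAt_Iic_of_tendsto_deriv (s := Ioo a b)
    (fun t ht => (hγ.2 t ht).differentiableAt.differentiableWithinAt)
    ((hγ.1 b (right_mem_Icc.2 hab.le)).mono Ioo_subset_Icc_self) hmem ?_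
  refine ((hv.tendsto _).comp hlim).congr' ?_
  filter_upwards [hmem] with t ht using (hγ.2 t ht).deriv.symm

theorem SolvesOn.hasDerivWithinAt_Ici (hv : Continuous v) (hγ : SolvesOn v γ a b) (hab : a < b) :
    HasDerivWithinAt γ (v (γ a)) (Ici a) a := by
  have hmem : Ioo a b ∈ nhdsWithin a (Ioi a) := Ioo_mem_nhdsGT hab
  have hlim : Tendsto γ (nhdsWithin a (Ioi a)) (nhds (γ a)) :=
    ((hγ.1 a (left_mem_Icc.2 hab.le)).mono Ioo_subset_Icc_self).mono_left
      (nhdsWithin_le_iff.2 hmem)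
  refine hasDerivWithinAt_Ici_of_tendsto_deriv (s := Ioo a b)
    (fun t ht => (hγ.2 t ht).differentiableAt.differentiableWithinAt)
    ((hγ.1 a (left_mem_Icc.2 hab.le)).mono Ioo_subset_Icc_self) hmem ?_
  refine ((hv.tendsto _).comp hlim).congr' ?_
  filter_upwards [hmem] with t ht using (hγ.2 t ht).deriv.symm

theorem SolvesOn.glue (hv : Continuous v) (hγ : SolvesOn v γ a b) (hφ : SolvesOn v φ b c)
    (hab : a < b) (hbc : b < c) (h : γ b = φ b) :
    SolvesOn v (fun t => if t ≤ b then γ t else φ t) a c := by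
  set ψ : ℝ → E := fun t => if t ≤ b then γ t else φ t with hψ
  have hl : EqOn ψ γ (Iic b) := fun t ht => if_pos ht
  have hr : EqOn ψ φ (Ici b) := fun t ht => by
    rcases eq_or_lt_of_le (mem_Ici.1 ht) with rfl | ht'
    · simp [hψ, h]
    · simp [hψ, not_le.2 ht']
  refine ⟨?_, fun t ht => ?_⟩
  · rw [← Icc_union_Icc_eq_Icc hab.le hbc.le]
    exact (hγ.1.congr (hl.mono Icc_subset_Iic_self)).union_of_isClosed
      (hφ.1.congr (hr.mono Icc_subset_Ici_self)) isClosed_Icc isClosed_Icc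
  · rcases lt_trichotomy t b with htb | rfl | htb
    · have := hγ.2 t ⟨ht.1, htb⟩
      rw [hl htb.le]
      exact this.congr_of_eventuallyEq (hl.eventuallyEq_of_mem (Iic_mem_nhds htb))
    · have h₁ := (hγ.hasDerivWithinAt_Iic hv hab).congr_of_mem hl self_mem_Iic
      have h₂ := (hφ.hasDerivWithinAt_Ici hv hbc).congr_of_mem hr self_mem_Ici
      rw [← h] at h₂
      have := h₁.union h₂
      rw [Iic_union_Ici, hasDerivWithinAt_univ] at this
      rwa [hl self_mem_Iic]
    · have := hφ.2 t ⟨htb, ht.2⟩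
      rw [hr htb.le]
      exact this.congr_of_eventuallyEq (hr.eventuallyEq_of_mem (Ici_mem_nhds htb))

/-- A Lipschitz autonomous field has solutions on time intervals of length independent of the
initial value. -/
theorem LipschitzWith.exists_solvesOn [CompleteSpace E] {K : NNReal} (hv : LipschitzWith K v)
    (hv0 : v 0 = 0) (x : E) (b : ℝ) :
    ∃ φ : ℝ → E, φ b = x ∧ SolvesOn v φ b (b + 1 / (2 * K + 1)) := by
  have hK : (0 : ℝ) ≤ K := K.2
  have hε : (0 : ℝ) < 1 / (2 * K + 1) := by positivity
  have hP : IsPicardLindelof (fun _ => v) (tmin := b) (tmax := b + 1 / (2 * K + 1))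
      ⟨b, left_mem_Icc.2 (by linarith)⟩ x (‖x‖₊ + 1) 0 (K * (2 * ‖x‖₊ + 1)) K := by
    refine ⟨fun _ _ => hv.lipschitzOnWith, fun _ _ => continuousOn_const, fun _ _ y hy => ?_, ?_⟩
    · have h1 : ‖v y‖ ≤ K * ‖y‖ := by
        simpa [hv0, dist_eq_norm] using hv.dist_le_mul y 0
      have h2 : ‖y‖ ≤ 2 * ‖x‖ + 1 := by
        have := norm_le_norm_add_norm_sub' y x
        have h3 : ‖y - x‖ ≤ ‖x‖ + 1 := by
          simpa [dist_eq_norm] using hy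
        linarith
      simpa using h1.trans (mul_le_mul_of_nonneg_left h2 hK)
    · have : max (1 / (2 * (K : ℝ) + 1)) 0 = 1 / (2 * K + 1) := max_eq_left hε.le
      simp only [add_sub_cancel_left, sub_self, this]
      push_cast
      rw [mul_one_div, div_le_iff₀ (by positivity)]
      have := norm_nonneg x
      nlinarith [mul_nonneg hK this]
  obtain ⟨φ, hφ0, hφ⟩ := hP.exists_eq_forall_mem_Icc_hasDerivWithinAt₀
  exact ⟨φ, hφ0, fun t ht => (hφ t ht).continuousWithinAt, fun t ht =>
    (hφ t (Ioo_subset_Icc_self ht)).hasDerivAt (Icc_mem_nhds ht.1 ht.2)⟩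

/-- Solutions of a Lipschitz autonomous equation extend to `[0, ∞)`. -/
theorem SolvesOn.exists_extension [CompleteSpace E] {K : NNReal} (hv : LipschitzWith K v)
    (hv0 : v 0 = 0) (hb : 0 < b) (hγ : SolvesOn v γ 0 b) :
    ∃ φ : ℝ → E, EqOn φ γ (Icc 0 b) ∧ ContinuousOn φ (Ici 0) ∧
      ∀ t, 0 < t → HasDerivAt φ (v (φ t)) t := by
  set ε : ℝ := 1 / (2 * K + 1)
  have hε : 0 < ε := by positivity
  have step : ∀ (n : ℕ) (g : ℝ → E), ∃ g' : ℝ → E, SolvesOn v g 0 (b + n * ε) →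
      SolvesOn v g' 0 (b + (n + 1 : ℕ) * ε) ∧ EqOn g' g (Icc 0 (b + n * ε)) := by
    intro n g
    obtain ⟨φ, h0, hφ⟩ := hv.exists_solvesOn hv0 (g (b + n * ε)) (b + n * ε)
    refine ⟨fun t => if t ≤ b + n * ε then g t else φ t, fun hg => ⟨?_, fun t ht => if_pos ht.2⟩⟩
    · have := hg.glue hv.continuous hφ (by positivity) (by linarith) h0.symm
      convert this using 1
      push_cast
      ring
  choose next hnext using step
  let g : ℕ → ℝ → E := fun n => Nat.rec γ next n
  have hg : ∀ n : ℕ, SolvesOn v (g n) 0 (b + n * ε) := by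
    intro n
    induction n with
    | zero => simpa [g] using hγ
    | succ n ih => exact (hnext n (g n) ih).1
  have hmono : ∀ n m : ℕ, n ≤ m → EqOn (g m) (g n) (Icc 0 (b + n * ε)) := by
    intro n m hnm
    induction m, hnm using Nat.le_induction with
    | base => exact fun _ _ => rfl
    | succ m hnm ih =>
      intro t ht
      have hle : (n : ℝ) * ε ≤ m * ε := by gcongr
      exact ((hnext m (g m) (hg m)).2 ⟨ht.1, ht.2.trans (by linarith)⟩).trans (ih ht)
  set ψ : ℝ → E := fun t => g ⌈t / ε⌉₊ t
  have hceil : ∀ t, t ≤ ⌈t / ε⌉₊ * ε := fun t => (div_le_iff₀ hε).1 (Nat.le_ceil _)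
  have heq : ∀ n : ℕ, EqOn ψ (g n) (Icc 0 (b + n * ε)) := by
    intro n t ht
    rcases le_total n ⌈t / ε⌉₊ with h | h
    · exact hmono _ _ h ht
    · exact (hmono _ _ h ⟨ht.1, (hceil t).trans (by linarith)⟩).symm
  have hlt : ∀ t, t < b + ⌈t / ε⌉₊ * ε := fun t => by linarith [hceil t]
  refine ⟨ψ, by simpa [g] using heq 0, fun t ht => ?_, fun t ht => ?_⟩
  · have h := ((hg ⌈t / ε⌉₊).1.congr (heq _)) t ⟨ht, (hlt t).le⟩
    refine h.mono_of_mem_nhdsWithin ?_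
    rw [← Ici_inter_Iic]
    exact inter_mem self_mem_nhdsWithin (mem_nhdsWithin_of_mem_nhds (Iic_mem_nhds (hlt t)))
  · have h := (hg ⌈t / ε⌉₊).2 t ⟨ht, hlt t⟩
    exact h.congr_of_eventuallyEq ((heq _).eventuallyEq_of_mem (Icc_mem_nhds ht (hlt t)))

/-- An exponential estimate along global solutions of a Lipschitz equation also holds along
solutions on a compact interval. -/
theorem SolvesOn.le_mul_exp [CompleteSpace E] {K : NNReal} (hv : LipschitzWith K v)
    (hv0 : v 0 = 0) {W : E → ℝ} {r : ℝ}
    (hW : ∀ γ : ℝ → E, ContinuousOn γ (Ici 0) → (∀ t, 0 < t → HasDerivAt γ (v (γ t)) t) →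
      ∀ t, 0 ≤ t → W (γ t) ≤ W (γ 0) * Real.exp (-r * t))
    (hab : a ≤ b) (hγ : SolvesOn v γ a b) :
    W (γ b) ≤ W (γ a) * Real.exp (-r * (b - a)) := by
  rcases hab.eq_or_lt with rfl | hab
  · simp
  have hs : SolvesOn v (fun t => γ (t + a)) 0 (b - a) := by
    refine ⟨hγ.1.comp (by fun_prop) fun t ht => ⟨by linarith [ht.1], by linarith [ht.2]⟩,
      fun t ht => ?_⟩
    exact (hγ.2 (t + a) ⟨by linarith [ht.1], by linarith [ht.2]⟩).comp_add_const t a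
  obtain ⟨φ, heq, hφc, hφd⟩ := hs.exists_extension hv hv0 (sub_pos.2 hab)
  have h := hW φ hφc hφd (b - a) (sub_pos.2 hab).le
  rw [heq (right_mem_Icc.2 (sub_pos.2 hab).le), heq (left_mem_Icc.2 (sub_pos.2 hab).le)] at h
  simpa using h

end GlobalExistence

namespace SwitchSig

variable {P : Type*} (S : SwitchSig P)

variable {S} in
theorem tau_le_iff {n i : ℕ} {t : ℝ} (h₁ : S.tau n ≤ t) (h₂ : t < S.tau (n + 1)) :
    S.tau i ≤ t ↔ i ≤ n :=
  ⟨fun h => Nat.lt_succ_iff.1 (S.mono.lt_iff_lt.1 (h.trans_lt h₂)),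
    fun h => (S.mono.monotone h).trans h₁⟩

variable {S} in
theorem N_eq {n : ℕ} {t : ℝ} (h₁ : S.tau n ≤ t) (h₂ : t < S.tau (n + 1)) : S.N 0 t = n := by
  have : {i : ℕ | 0 < S.tau i ∧ S.tau i ≤ t} = (Finset.Ioc 0 n : Finset ℕ) := by
    ext i
    have : 0 < S.tau i ↔ 0 < i := by
      conv_lhs => rw [← S.tau0]
      exact S.mono.lt_iff_lt
    simp [tau_le_iff h₁ h₂, this]
  rw [N, this, ncard_coe_finset, Nat.card_Ioc, Nat.sub_zero]

open Classical in
variable {S} in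
theorem Ntrans_eq (k l : P) {n : ℕ} {t : ℝ} (h₁ : S.tau n ≤ t) (h₂ : t < S.tau (n + 1)) :
    S.Ntrans k l t = ((Finset.range n).filter fun i =>
      S.sig (S.tau i) = k ∧ S.sig (S.tau (i + 1)) = l).card := by
  rw [← ncard_coe_finset, Ntrans]
  congr 1
  ext i
  simp [tau_le_iff h₁ h₂]

theorem Ntrans_le_N (k l : P) {t : ℝ} (ht : 0 ≤ t) : S.Ntrans k l t ≤ S.N 0 t := by
  classical
  obtain ⟨n, h₁, h₂⟩ := S.exists_tau_le_lt ht
  rw [Ntrans_eq k l h₁ h₂, N_eq h₁ h₂]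
  exact (Finset.card_filter_le _ _).trans_eq (Finset.card_range n)

theorem N_mono {s t : ℝ} (hs : 0 ≤ s) (hst : s ≤ t) : S.N 0 s ≤ S.N 0 t := by
  obtain ⟨n, h₁, h₂⟩ := S.exists_tau_le_lt hs
  obtain ⟨m, h₃, h₄⟩ := S.exists_tau_le_lt (hs.trans hst)
  rw [N_eq h₁ h₂, N_eq h₃ h₄]
  exact (tau_le_iff h₃ h₄).1 (h₁.trans hst)

theorem Ntrans_congr (k l : P) {n : ℕ} {t : ℝ} (h₁ : S.tau n ≤ t) (h₂ : t < S.tau (n + 1)) :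
    S.Ntrans k l t = S.Ntrans k l (S.tau n) := by
  classical
  rw [Ntrans_eq k l h₁ h₂, Ntrans_eq k l le_rfl (S.mono n.lt_succ_self)]

theorem T_eq_Ico (j : P) (t : ℝ) :
    S.T j 0 t = (volume (Ico 0 t ∩ S.sig ⁻¹' {j})).toReal := by
  have : {r : ℝ | 0 < r ∧ r ≤ t ∧ S.sig r = j} = Ioc 0 t ∩ S.sig ⁻¹' {j} := by
    ext r
    simp [and_assoc]
  rw [T, this]
  congr 1
  exact measure_congr ((Ioc_ae_eq_Icc.trans Ico_ae_eq_Icc.symm).inter (ae_eq_refl _))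

open Classical in
theorem T_eq_add (j : P) {n : ℕ} {t : ℝ} (h₁ : S.tau n ≤ t) (h₂ : t ≤ S.tau (n + 1)) :
    S.T j 0 t = S.T j 0 (S.tau n) + if S.sig (S.tau n) = j then t - S.tau n else 0 := by
  have hpiece : Ico (S.tau n) t ∩ S.sig ⁻¹' {j} =
      if S.sig (S.tau n) = j then Ico (S.tau n) t else ∅ := by
    ext r
    have hc := S.const n r
    split_ifs with h
    · simp only [mem_inter_iff, mem_Ico, mem_preimage, mem_singleton_iff, and_iff_left_iff_imp]
      exact fun hr => (hc hr.1 (hr.2.trans_le h₂)).trans h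
    · simp only [mem_inter_iff, mem_Ico, mem_preimage, mem_singleton_iff, mem_empty_iff_false,
        iff_false, not_and]
      exact fun hr hj => h ((hc hr.1 (hr.2.trans_le h₂)).symm.trans hj)
  rw [T_eq_Ico, T_eq_Ico, ← Ico_union_Ico_eq_Ico (S.tau_nonneg n) h₁, union_inter_distrib_right,
    hpiece, measure_union, ENNReal.toReal_add]
  · split_ifs
    · simp [h₁]
    · simp
  · exact measure_ne_top_of_subset inter_subset_left (by simp)
  · split_ifs <;> simp
  · rw [← hpiece]
    exact (Ico_disjoint_Ico_same).mono inter_subset_left inter_subset_left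
  · split_ifs <;> measurability

/-- The logarithm of the total gain accumulated up to time `t`, when a transition `p` contributes
`w p` and one unit of time spent in mode `j` contributes `-lam j`. -/
def logGain (E : Finset (P × P)) (PS PU : Finset P) (w : P × P → ℝ) (lam : P → ℝ) (t : ℝ) : ℝ :=
  ∑ p ∈ E, w p * S.Ntrans p.1 p.2 t
    - (∑ j ∈ PS, lam j * S.T j 0 t + ∑ k ∈ PU, lam k * S.T k 0 t)

section logGain

variable {S} {E : Finset (P × P)} {PS PU : Finset P} {w : P × P → ℝ} {lam : P → ℝ}

theorem logGain_zero : S.logGain E PS PU w lam 0 = 0 := by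
  have hN (k l : P) : S.Ntrans k l 0 = 0 := by
    have := S.Ntrans_le_N k l le_rfl
    rw [N_eq (n := 0) S.tau0.le (by simpa [S.tau0] using S.mono Nat.zero_lt_one)] at this
    omega
  have hT (j : P) : S.T j 0 0 = 0 := (S.T_le j le_rfl).antisymm (S.T_nonneg j 0 0)
  simp [logGain, hN, hT]

theorem sum_mul_T (hcover : ∀ i : P, i ∈ PS ∨ i ∈ PU) (hdisj : Disjoint PS PU) {n : ℕ} {t : ℝ}
    (h₁ : S.tau n ≤ t) (h₂ : t ≤ S.tau (n + 1)) :
    ∑ j ∈ PS, lam j * S.T j 0 t + ∑ k ∈ PU, lam k * S.T k 0 t =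
      ∑ j ∈ PS, lam j * S.T j 0 (S.tau n) + ∑ k ∈ PU, lam k * S.T k 0 (S.tau n)
        + lam (S.sig (S.tau n)) * (t - S.tau n) := by
  classical
  simp only [S.T_eq_add _ h₁ h₂, mul_add, Finset.sum_add_distrib, mul_ite, mul_zero,
    Finset.sum_ite_eq]
  rcases hcover (S.sig (S.tau n)) with h | h
  · rw [if_pos h, if_neg (Finset.disjoint_left.1 hdisj h)]
    ring
  · rw [if_pos h, if_neg (Finset.disjoint_right.1 hdisj h)]
    ring

theorem logGain_of_mem_Ico (hcover : ∀ i : P, i ∈ PS ∨ i ∈ PU) (hdisj : Disjoint PS PU)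
    {n : ℕ} {t : ℝ} (h₁ : S.tau n ≤ t) (h₂ : t < S.tau (n + 1)) :
    S.logGain E PS PU w lam t = S.logGain E PS PU w lam (S.tau n)
      + -lam (S.sig (S.tau n)) * (t - S.tau n) := by
  simp only [logGain, sum_mul_T hcover hdisj h₁ h₂.le, S.Ntrans_congr _ _ h₁ h₂]
  ring

theorem logGain_tau_succ (hcover : ∀ i : P, i ∈ PS ∨ i ∈ PU) (hdisj : Disjoint PS PU) {n : ℕ}
    (hadm : (S.sig (S.tau n), S.sig (S.tau (n + 1))) ∈ E) :
    S.logGain E PS PU w lam (S.tau (n + 1)) = S.logGain E PS PU w lam (S.tau n)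
      + -lam (S.sig (S.tau n)) * (S.tau (n + 1) - S.tau n)
      + w (S.sig (S.tau n), S.sig (S.tau (n + 1))) := by
  classical
  simp only [logGain, sum_mul_T hcover hdisj (S.mono n.lt_succ_self).le le_rfl, S.Ntrans_tau_succ,
    Nat.cast_add, Nat.cast_ite, Nat.cast_one, Nat.cast_zero, mul_add, Finset.sum_add_distrib,
    mul_ite, mul_one, mul_zero, Prod.mk.eta, Finset.sum_ite_eq, if_pos hadm]
  ring

/-- Along a solution, the Lyapunov function of the active mode is controlled by the accumulated
gain. -/
theorem lyapunov_le {F : Type*} [NormedAddCommGroup F] [NormedSpace ℝ F] [CompleteSpace F]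
    {f : P → F → F} {V : P → F → ℝ} {mu : P → P → ℝ} {lo hi : ℝ → ℝ}
    (hcover : ∀ i : P, i ∈ PS ∨ i ∈ PU) (hdisj : Disjoint PS PU)
    (hLip : ∀ i : P, ∃ K : NNReal, LipschitzWith K (f i)) (hzero : ∀ i : P, f i 0 = 0)
    (hadm : ∀ i : ℕ, (S.sig (S.tau i), S.sig (S.tau (i + 1))) ∈ E)
    (h1 : Assumption1 f V lam PS PU lo hi) (h2 : Assumption2 V mu E)
    {x : ℝ → F} (hx : IsSolution S f x) {t : ℝ} (ht : 0 ≤ t) :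
    V (S.sig t) (x t) ≤ V (S.sig 0) (x 0) *
      Real.exp (S.logGain E PS PU (fun p => Real.log (mu p.1 p.2)) lam t) := by
  obtain ⟨-, -, -, -, -, -, -, hdecay⟩ := h1
  have hflow (n : ℕ) (t : ℝ) (h₁ : S.tau n ≤ t) (h₂ : t ≤ S.tau (n + 1)) :
      V (S.sig (S.tau n)) (x t) ≤ V (S.sig (S.tau n)) (x (S.tau n)) *
        Real.exp (-lam (S.sig (S.tau n)) * (t - S.tau n)) := by
    obtain ⟨K, hK⟩ := hLip (S.sig (S.tau n))
    refine SolvesOn.le_mul_exp hK (hzero _) (hdecay _) h₁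
      ⟨hx.1.mono fun r hr => (S.tau_nonneg n).trans hr.1, fun r hr => ?_⟩
    have hr' := hr.2.trans_le h₂
    have := hx.2 n r hr.1 hr'
    rwa [S.const n r hr.1.le hr'] at this
  have hinst (n : ℕ) : V (S.sig (S.tau n)) (x (S.tau n)) ≤ V (S.sig 0) (x 0) *
      Real.exp (S.logGain E PS PU (fun p => Real.log (mu p.1 p.2)) lam (S.tau n)) := by
    induction n with
    | zero => simp [S.tau0, logGain_zero]
    | succ n ih =>
      obtain ⟨hmu, hjump⟩ := h2 _ (hadm n)
      have hmu0 : 0 < mu (S.sig (S.tau n)) (S.sig (S.tau (n + 1))) := one_pos.trans_le hmu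
      calc _ ≤ mu (S.sig (S.tau n)) (S.sig (S.tau (n + 1))) *
            V (S.sig (S.tau n)) (x (S.tau (n + 1))) := hjump _
        _ ≤ mu (S.sig (S.tau n)) (S.sig (S.tau (n + 1))) * ((V (S.sig 0) (x 0) *
            Real.exp (S.logGain E PS PU (fun p => Real.log (mu p.1 p.2)) lam (S.tau n))) *
            Real.exp (-lam (S.sig (S.tau n)) * (S.tau (n + 1) - S.tau n))) := by
          gcongr
          exact (hflow n _ (S.mono n.lt_succ_self).le le_rfl).trans (by gcongr)
        _ = _ := by
          rw [logGain_tau_succ hcover hdisj (hadm n), Real.exp_add, Real.exp_add,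
            Real.exp_log hmu0]
          ring
  obtain ⟨n, h₁, h₂⟩ := S.exists_tau_le_lt ht
  rw [S.const n t h₁ h₂, logGain_of_mem_Ico hcover hdisj h₁ h₂, Real.exp_add, ← mul_assoc]
  exact (hflow n t h₁ h₂.le).trans (by gcongr; exact hinst n)

end logGain

section Asymptotics

theorem nu_nonneg {t : ℝ} (ht : 0 ≤ t) : 0 ≤ S.nu t := by
  unfold nu
  positivity

theorem rho_nonneg (k l : P) (t : ℝ) : 0 ≤ S.rho k l t := by
  unfold rho
  positivity

theorem rho_le_one (k l : P) {t : ℝ} (ht : 0 ≤ t) : S.rho k l t ≤ 1 :=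
  div_le_one_of_le₀ (by exact_mod_cast S.Ntrans_le_N k l ht) (by positivity)

theorem eta_nonneg (j : P) {t : ℝ} (ht : 0 ≤ t) : 0 ≤ S.eta j t :=
  div_nonneg (S.T_nonneg j 0 t) ht

theorem eta_le_one (j : P) {t : ℝ} (ht : 0 ≤ t) : S.eta j t ≤ 1 :=
  div_le_one_of_le₀ (S.T_le j ht) ht

theorem Ntrans_eq_mul (k l : P) {t : ℝ} (ht : 0 < t) :
    (S.Ntrans k l t : ℝ) = S.nu t * S.rho k l t * t := by
  rcases Nat.eq_zero_or_pos (S.N 0 t) with h | h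
  · have := S.Ntrans_le_N k l ht.le
    simp [nu, h, show S.Ntrans k l t = 0 by omega]
  · have : (0 : ℝ) < S.N 0 t := by exact_mod_cast h
    unfold nu rho
    field_simp

theorem T_eq_mul (j : P) {t : ℝ} (ht : 0 < t) : S.T j 0 t = S.eta j t * t := by
  unfold eta
  field_simp

variable {S} {E : Finset (P × P)} {PS PU : Finset P} {w : P × P → ℝ} {lam : P → ℝ}

theorem exists_logGain_le
    (hS : ∀ j ∈ PS, 0 < lam j) (hU : ∀ k ∈ PU, lam k < 0) (hw : ∀ p ∈ E, 0 ≤ w p)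
    (hfin : limsup (fun t : ℝ => ((S.nu t : ℝ) : EReal)) atTop < (⊤ : EReal))
    (hcond : limsup (fun t : ℝ => S.nu t) atTop *
          (∑ p ∈ E, w p * limsup (fun t : ℝ => S.rho p.1 p.2 t) atTop)
        < (∑ j ∈ PS, |lam j| * liminf (fun t : ℝ => S.eta j t) atTop)
          - ∑ k ∈ PU, |lam k| * limsup (fun t : ℝ => S.eta k t) atTop) :
    ∃ c > 0, ∀ᶠ t in atTop, S.logGain E PS PU w lam t ≤ -c * t := by
  have hnub : IsBoundedUnder (· ≤ ·) atTop (fun t : ℝ => S.nu t) := by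
    obtain ⟨b, hb, -⟩ := EReal.lt_iff_exists_real_btwn.1 hfin
    exact isBoundedUnder_of_eventually_le
      ((eventually_lt_of_limsup_lt hb).mono fun t ht => (EReal.coe_lt_coe_iff.1 ht).le)
  have hrhob (k l : P) : IsBoundedUnder (· ≤ ·) atTop (fun t : ℝ => S.rho k l t) :=
    isBoundedUnder_of_eventually_le ((eventually_ge_atTop 0).mono fun t => S.rho_le_one k l)
  have hetab (j : P) : IsBoundedUnder (· ≤ ·) atTop (fun t : ℝ => S.eta j t) :=
    isBoundedUnder_of_eventually_le ((eventually_ge_atTop 0).mono fun t => S.eta_le_one j)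
  have hetab' (j : P) : IsBoundedUnder (· ≥ ·) atTop (fun t : ℝ => S.eta j t) :=
    isBoundedUnder_of_eventually_ge ((eventually_ge_atTop 0).mono fun t => S.eta_nonneg j)
  set L := limsup (fun t : ℝ => S.nu t) atTop
  set R : P × P → ℝ := fun p => limsup (fun t : ℝ => S.rho p.1 p.2 t) atTop
  set l : P → ℝ := fun j => liminf (fun t : ℝ => S.eta j t) atTop
  set u : P → ℝ := fun j => limsup (fun t : ℝ => S.eta j t) atTop
  let h : ℝ → ℝ := fun ε => ∑ p ∈ E, w p * ((L + ε) * (R p + ε))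
    - (∑ j ∈ PS, |lam j| * (l j - ε) - ∑ k ∈ PU, |lam k| * (u k + ε))
  have hcont : Continuous h := by fun_prop
  have h0 : h 0 < 0 := by
    have : ∑ p ∈ E, w p * (L * R p) = L * ∑ p ∈ E, w p * R p := by
      rw [Finset.mul_sum]
      exact Finset.sum_congr rfl fun p _ => by ring
    simp only [h, add_zero, sub_zero, this]
    linarith
  obtain ⟨ε, hhε, hε⟩ : ∃ ε, h ε < 0 ∧ 0 < ε :=
    (((hcont.tendsto 0).mono_left (nhdsWithin_le_nhds (s := Ioi 0))).eventually_lt_const h0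
      |>.and self_mem_nhdsWithin).exists
  refine ⟨-h ε, neg_pos.2 hhε, ?_⟩
  have e1 : ∀ᶠ t in atTop, S.nu t < L + ε :=
    eventually_lt_of_limsup_lt (lt_add_of_pos_right L hε) hnub
  have e2 : ∀ᶠ t in atTop, ∀ p ∈ E, S.rho p.1 p.2 t < R p + ε :=
    (Finset.eventually_all E).2 fun p _ =>
      eventually_lt_of_limsup_lt (lt_add_of_pos_right (R p) hε) (hrhob p.1 p.2)
  have e3 : ∀ᶠ t in atTop, ∀ j ∈ PS, l j - ε < S.eta j t :=
    (Finset.eventually_all PS).2 fun j _ =>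
      eventually_lt_of_lt_liminf (sub_lt_self (l j) hε) (hetab' j)
  have e4 : ∀ᶠ t in atTop, ∀ k ∈ PU, S.eta k t < u k + ε :=
    (Finset.eventually_all PU).2 fun k _ =>
      eventually_lt_of_limsup_lt (lt_add_of_pos_right (u k) hε) (hetab k)
  filter_upwards [e1, e2, e3, e4, eventually_gt_atTop 0] with t t1 t2 t3 t4 ht
  have s1 : ∑ p ∈ E, w p * S.Ntrans p.1 p.2 t ≤ (∑ p ∈ E, w p * ((L + ε) * (R p + ε))) * t := by
    rw [Finset.sum_mul]
    refine Finset.sum_le_sum fun p hp => ?_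
    rw [S.Ntrans_eq_mul _ _ ht, mul_assoc (w p)]
    have := hw p hp
    have := S.nu_nonneg ht.le
    have := S.rho_nonneg p.1 p.2 t
    have := t2 p hp
    gcongr
    linarith
  have s2 : (∑ j ∈ PS, |lam j| * (l j - ε)) * t ≤ ∑ j ∈ PS, lam j * S.T j 0 t := by
    rw [Finset.sum_mul]
    refine Finset.sum_le_sum fun j hj => ?_
    rw [S.T_eq_mul _ ht, abs_of_pos (hS j hj), mul_assoc]
    have := hS j hj
    have := t3 j hj
    gcongr
  have s3 : -((∑ k ∈ PU, |lam k| * (u k + ε)) * t) ≤ ∑ k ∈ PU, lam k * S.T k 0 t := by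
    rw [Finset.sum_mul, ← Finset.sum_neg_distrib]
    refine Finset.sum_le_sum fun k hk => ?_
    rw [S.T_eq_mul _ ht, abs_of_neg (hU k hk), neg_mul, neg_mul, neg_neg, mul_assoc]
    have := t4 k hk
    exact mul_le_mul_of_nonpos_left (by gcongr) (hU k hk).le
  simp only [logGain, h]
  linarith

theorem exists_logGain_le_const {c : ℝ} (hc : 0 < c) (hw : ∀ p ∈ E, 0 ≤ w p)
    (h : ∀ᶠ t in atTop, S.logGain E PS PU w lam t ≤ -c * t) :
    ∃ M, ∀ t, 0 ≤ t → S.logGain E PS PU w lam t ≤ M := by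
  obtain ⟨t₀, ht₀⟩ := eventually_atTop.1 h
  set t₁ := max t₀ 0
  have hT (Q : Finset P) {t : ℝ} (ht : 0 ≤ t) (htt : t ≤ t₁) :
      -∑ j ∈ Q, |lam j| * t₁ ≤ ∑ j ∈ Q, lam j * S.T j 0 t := by
    rw [← Finset.sum_neg_distrib]
    refine Finset.sum_le_sum fun j _ => (neg_le_neg ?_).trans (neg_abs_le _)
    rw [abs_mul, abs_of_nonneg (S.T_nonneg j 0 t)]
    gcongr
    exact (S.T_le j ht).trans htt
  set B := ∑ p ∈ E, w p * S.N 0 t₁ + (∑ j ∈ PS, |lam j| * t₁ + ∑ k ∈ PU, |lam k| * t₁)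
  refine ⟨max B 0, fun t ht => ?_⟩
  rcases le_total t t₁ with htt | htt
  · refine le_max_of_le_left ?_
    have hN : ∑ p ∈ E, w p * S.Ntrans p.1 p.2 t ≤ ∑ p ∈ E, w p * S.N 0 t₁ :=
      Finset.sum_le_sum fun p hp => mul_le_mul_of_nonneg_left
        (by exact_mod_cast (S.Ntrans_le_N _ _ ht).trans (S.N_mono ht htt)) (hw p hp)
    have h₁ := hT PS ht htt
    have h₂ := hT PU ht htt
    simp only [logGain, B]
    linarith
  · refine le_max_of_le_right ((ht₀ t ((le_max_left _ _).trans htt)).trans ?_)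
    nlinarith

end Asymptotics

end SwitchSig

theorem ClassKInf.pos {g : ℝ → ℝ} (hg : ClassKInf g) {r : ℝ} (hr : 0 < r) : 0 < g r := by
  obtain ⟨-, hmono, h0, -⟩ := hg
  simpa [h0] using hmono self_mem_Ici hr.le hr

theorem stmt4 {d : ℕ} {P : Type*}
    (S : SwitchSig P)
    (f : P → EuclideanSpace ℝ (Fin d) → EuclideanSpace ℝ (Fin d))
    (PS PU : Finset P) (Eadm : Finset (P × P))
    (V : P → EuclideanSpace ℝ (Fin d) → ℝ) (lam : P → ℝ) (mu : P → P → ℝ)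
    (lo hi : ℝ → ℝ)
    (hcover : ∀ i : P, i ∈ PS ∨ i ∈ PU) (hdisj : Disjoint PS PU)
    (hLip : ∀ i : P, ∃ K : NNReal, LipschitzWith K (f i))
    (hzero : ∀ i : P, f i 0 = 0)
    (hadm : ∀ i : ℕ, (S.sig (S.tau i), S.sig (S.tau (i + 1))) ∈ Eadm)
    (h1 : Assumption1 f V lam PS PU lo hi)
    (h2 : Assumption2 V mu Eadm)
    (hfin : Filter.limsup (fun t : ℝ => ((S.nu t : ℝ) : EReal)) Filter.atTop < (⊤ : EReal))
    (hcond : (Filter.limsup (fun t : ℝ => S.nu t) Filter.atTop) *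
          (∑ p ∈ Eadm, Real.log (mu p.1 p.2) *
            Filter.limsup (fun t : ℝ => S.rho p.1 p.2 t) Filter.atTop)
        < (∑ j ∈ PS, |lam j| * Filter.liminf (fun t : ℝ => S.eta j t) Filter.atTop)
          - ∑ k ∈ PU, |lam k| * Filter.limsup (fun t : ℝ => S.eta k t) Filter.atTop) :
    IsGAS S f := by
  have hmu : ∀ p ∈ Eadm, 0 ≤ Real.log (mu p.1 p.2) := fun p hp => Real.log_nonneg (h2 p hp).1
  have hbound : ∀ x, IsSolution S f x → ∀ t, 0 ≤ t → V (S.sig t) (x t) ≤ V (S.sig 0) (x 0) *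
      Real.exp (S.logGain Eadm PS PU (fun p => Real.log (mu p.1 p.2)) lam t) :=
    fun x hx t ht => SwitchSig.lyapunov_le hcover hdisj hLip hzero hadm h1 h2 hx ht
  obtain ⟨hlo, hhi, -, hV0, hS, hU, hsand, -⟩ := h1
  have hnorm : ∀ {ε : ℝ} {ξ : EuclideanSpace ℝ (Fin d)} {i : P}, 0 < ε → V i ξ < lo ε → ‖ξ‖ < ε :=
    fun {ε ξ i} hε h => (hlo.2.1.lt_iff_lt (norm_nonneg ξ) hε.le).1 ((hsand i ξ).1.trans_lt h)
  obtain ⟨c, hc, hdecay⟩ := SwitchSig.exists_logGain_le hS hU hmu hfin hcond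
  refine ⟨fun ε hε => ?_, fun x hx => ?_⟩
  · obtain ⟨M, hM⟩ := SwitchSig.exists_logGain_le_const hc hmu hdecay
    have hlim : Tendsto (fun r => hi r * Real.exp M) (nhdsWithin 0 (Ici 0)) (nhds 0) := by
      simpa [hhi.2.2.1] using (hhi.1 0 self_mem_Ici).tendsto.mul_const (Real.exp M)
    obtain ⟨δ, hδ, hsub⟩ := Metric.mem_nhdsWithin_iff.1 (hlim.eventually_lt_const (hlo.pos hε))
    refine ⟨δ, hδ, fun x hx hx0 t ht => hnorm (i := S.sig t) hε ?_⟩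
    calc V (S.sig t) (x t) ≤ _ := hbound x hx t ht
      _ ≤ hi ‖x 0‖ * Real.exp M :=
        mul_le_mul (hsand _ _).2 (Real.exp_le_exp.2 (hM t ht)) (Real.exp_pos _).le
          ((hV0 (S.sig 0) (x 0)).trans (hsand _ _).2)
      _ < lo ε := hsub ⟨by simpa using hx0, norm_nonneg (x 0)⟩
  · rw [tendsto_zero_iff_norm_tendsto_zero, Metric.tendsto_nhds]
    intro ε hε
    have hlim : Tendsto (fun t => V (S.sig 0) (x 0) * Real.exp (-c * t)) atTop (nhds 0) := by
      simpa using (Real.tendsto_exp_atBot.comp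
        (tendsto_id.const_mul_atTop_of_neg (neg_lt_zero.2 hc))).const_mul (V (S.sig 0) (x 0))
    filter_upwards [hlim.eventually_lt_const (hlo.pos hε), hdecay, eventually_ge_atTop 0]
      with t h₁ h₂ ht
    rw [dist_zero_right, norm_norm]
    refine hnorm (i := S.sig t) hε (((hbound x hx t ht).trans ?_).trans_lt h₁)
    exact mul_le_mul_of_nonneg_left (Real.exp_le_exp.2 h₂) (hV0 _ _)
end
end
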